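/- arXiv:1510.06394 — 5 statements merged into one kernel-verified Lean document; each statement's English description precedes it below -/
import Mathlib

section
/- Let F be uniformly elliptic with constants 0 < λ ≤ Λ and let u solve the fully nonlinear obstacle problem in Ω with obstacle φ semiconvex with quadratic modulus of semiconvexity ω(r) = C̄r². Fix x₁ ∈ {u > φ}, let x₀ ∈ {u = φ} be a closest contact point, i.e. ρ := |x₁ − x₀| = dist(x₁, {u = φ}), and assume B_{4ρ}(x₀) ⊂ Ω. Then there is a constant K > 0 depending only on n, λ, Λ, C̄ such that u(x₁) − L_{x₀}(x₁) ≤ K·ρ², where L_{x₀} is a linear part of φ at x₀. -/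
open MeasureTheory Metric Set
open scoped RealInnerProductSpace

noncomputable section

/-- Euclidean space ℝⁿ. -/
abbrev Euc (n : ℕ) := EuclideanSpace ℝ (Fin n)

/-- The operator norm of an `n × n` real matrix, viewed as a linear map on ℝⁿ. -/
def opNorm {n : ℕ} (A : Matrix (Fin n) (Fin n) ℝ) : ℝ :=
  ‖Matrix.toEuclideanCLM (𝕜 := ℝ) A‖

/-- The Hessian matrix `D²u(x)` of `u : ℝⁿ → ℝ` at `x`. -/
def hess2 {n : ℕ} (u : Euc n → ℝ) (x : Euc n) : Matrix (Fin n) (Fin n) ℝ :=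
  fun i j => iteratedFDeriv ℝ 2 u x ![EuclideanSpace.single i 1, EuclideanSpace.single j 1]

/-- `F` is uniformly elliptic with ellipticity constants `0 < lb ≤ ub`:
`lb‖P‖ ≤ F(A+P) − F(A) ≤ ub‖P‖` for all symmetric `A` and positive semidefinite `P`. -/
def UniformlyElliptic {n : ℕ} (F : Matrix (Fin n) (Fin n) ℝ → ℝ) (lb ub : ℝ) : Prop :=
  ∀ (A P : Matrix (Fin n) (Fin n) ℝ), A.IsSymm → P.PosSemidef →
    lb * opNorm P ≤ F (A + P) - F A ∧ F (A + P) - F A ≤ ub * opNorm P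

/-- `u` is a viscosity supersolution of `F(D²u) ≤ 0` in `U`: every C² test function
touching `u` from below at a point of `U` satisfies `F(D²ψ(x₀)) ≤ 0`. -/
def ViscSupersol {n : ℕ} (F : Matrix (Fin n) (Fin n) ℝ → ℝ) (U : Set (Euc n))
    (u : Euc n → ℝ) : Prop :=
  ∀ x₀ ∈ U, ∀ ψ : Euc n → ℝ, ContDiff ℝ 2 ψ → ψ x₀ = u x₀ →
    (∀ᶠ x in nhds x₀, ψ x ≤ u x) → F (hess2 ψ x₀) ≤ 0

/-- `u` is a viscosity subsolution of `F(D²u) ≥ 0` in `U`: every C² test function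
touching `u` from above at a point of `U` satisfies `F(D²ψ(x₀)) ≥ 0`. -/
def ViscSubsol {n : ℕ} (F : Matrix (Fin n) (Fin n) ℝ → ℝ) (U : Set (Euc n))
    (u : Euc n → ℝ) : Prop :=
  ∀ x₀ ∈ U, ∀ ψ : Euc n → ℝ, ContDiff ℝ 2 ψ → ψ x₀ = u x₀ →
    (∀ᶠ x in nhds x₀, u x ≤ ψ x) → 0 ≤ F (hess2 ψ x₀)

/-- `u` solves the fully nonlinear obstacle problem in `Ω` with obstacle `φ`:
`u ∈ C(Ω)`, `u ≥ φ` in `Ω`, `u` is a viscosity supersolution of `F(D²u) ≤ 0` in `Ω`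
and a viscosity solution of `F(D²u) = 0` in the non-contact set `{u > φ}`. -/
def SolvesObstacle {n : ℕ} (F : Matrix (Fin n) (Fin n) ℝ → ℝ) (Ω : Set (Euc n))
    (u φ : Euc n → ℝ) : Prop :=
  ContinuousOn u Ω ∧ (∀ x ∈ Ω, φ x ≤ u x) ∧ ViscSupersol F Ω u ∧
  ViscSupersol F {x ∈ Ω | φ x < u x} u ∧ ViscSubsol F {x ∈ Ω | φ x < u x} u

/-- A modulus: `ω : [0,∞) → [0,∞)` nondecreasing with `ω(0) = 0`. -/
def IsModulus (ω : ℝ → ℝ) : Prop :=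
  ω 0 = 0 ∧ MonotoneOn ω (Ici 0) ∧ ∀ r, 0 ≤ r → 0 ≤ ω r

/-- `φ` is semiconvex on `Ω` with modulus of semiconvexity `ω`: at every `x₀ ∈ Ω` there is
a slope `p` with `φ(x) ≥ φ(x₀) + ⟨p, x − x₀⟩ − ω(|x − x₀|)` on `Ω`. -/
def SemiconvexWithModulus {n : ℕ} (Ω : Set (Euc n)) (φ : Euc n → ℝ) (ω : ℝ → ℝ) : Prop :=
  ∀ x₀ ∈ Ω, ∃ p : Euc n, ∀ x ∈ Ω, φ x₀ + ⟪p, x - x₀⟫ - ω ‖x - x₀‖ ≤ φ x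

/-- `p` is the slope of a linear part of `φ` at `x₀` (for modulus `ω`). -/
def IsLinearPartSlope {n : ℕ} (Ω : Set (Euc n)) (φ : Euc n → ℝ) (ω : ℝ → ℝ)
    (x₀ : Euc n) (p : Euc n) : Prop :=
  ∀ x ∈ Ω, φ x₀ + ⟪p, x - x₀⟫ - ω ‖x - x₀‖ ≤ φ x

/-- `g` is semiconcave with modulus `ω` on `s`. -/
def SemiconcaveWithModulus {n : ℕ} (s : Set (Euc n)) (g : Euc n → ℝ) (ω : ℝ → ℝ) : Prop :=
  ∀ x h : Euc n, x ∈ s → x + h ∈ s → x - h ∈ s →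
    g (x + h) + g (x - h) - 2 * g x ≤ ω ‖h‖

/-- Componentwise order `x ≤ y` on ℝⁿ (`y − x` in the positive cone). -/
def coneLE {n : ℕ} (x y : Euc n) : Prop := ∀ i, x i ≤ y i

/-- The intervention operator `Mu(x) = φ(x) + inf{ u(y) : y ∈ D, y ≥ x }`. -/
def Mop {n : ℕ} (D : Set (Euc n)) (φ u : Euc n → ℝ) (x : Euc n) : ℝ :=
  φ x + sInf (u '' {y ∈ D | coneLE x y})

/-- A bounded domain with `C^{2,α}` boundary, via a global `C^{2,α}` defining function. -/
def IsC2AlphaDomain {n : ℕ} (Ω : Set (Euc n)) (α : ℝ) : Prop :=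
  ∃ ρ : Euc n → ℝ, ContDiff ℝ 2 ρ ∧ Ω = {x | ρ x < 0} ∧
    (∀ x ∈ frontier Ω, fderiv ℝ ρ x ≠ 0) ∧
    ∃ C : ℝ, 0 ≤ C ∧ ∀ x y : Euc n,
      ‖iteratedFDeriv ℝ 2 ρ x - iteratedFDeriv ℝ 2 ρ y‖ ≤ C * ‖x - y‖ ^ α

/-- `u` is a continuous viscosity solution of the fully nonlinear stochastic impulse
control problem on `Ω` with obstacle `Mu` built from `φ`: `u ∈ C(Ω̄)`, `u ≤ Mu` in `Ω`,
`u` is a viscosity subsolution of `F(D²u) ≥ 0` in `Ω`, a viscosity solution of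
`F(D²u) = 0` in `{u < Mu}`, `u = 0` on `∂Ω` and `u ≤ 0` on `Ω̄`. -/
def SolvesImpulse {n : ℕ} (F : Matrix (Fin n) (Fin n) ℝ → ℝ) (Ω : Set (Euc n))
    (u φ : Euc n → ℝ) : Prop :=
  ContinuousOn u (closure Ω) ∧
  (∀ x ∈ Ω, u x ≤ Mop (closure Ω) φ u x) ∧
  ViscSubsol F Ω u ∧
  ViscSubsol F {x ∈ Ω | u x < Mop (closure Ω) φ u x} u ∧
  ViscSupersol F {x ∈ Ω | u x < Mop (closure Ω) φ u x} u ∧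
  (∀ x ∈ frontier Ω, u x = 0) ∧ (∀ x ∈ closure Ω, u x ≤ 0)

section SecondOrder

open Filter Topology Module

variable {V : Type*} [NormedAddCommGroup V] [NormedSpace ℝ V]

/-- Additivity defect of the quadratic form `½ H a a` along one step of an almost radial chain. -/
lemma chain_step_antisymm_bound (H : V →L[ℝ] V →L[ℝ] ℝ) (v e₁ e₂ : V) {s k : ℝ}
    (hs0 : 0 ≤ s) (hs1 : s ≤ 1) (hk : 1 ≤ k)
    (he₁ : ‖e₁‖ ≤ 1 / k ^ 2 * ‖v‖) (he₂ : ‖e₂‖ ≤ 2 / k ^ 2 * ‖v‖) :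
    |H (s • v + e₁) (k⁻¹ • v + e₂) - H (k⁻¹ • v + e₂) (s • v + e₁)|
      ≤ 10 * ‖H‖ / k ^ 2 * ‖v‖ ^ 2 := by
  have hk0 : 0 < k := by linarith
  have hid : H (s • v + e₁) (k⁻¹ • v + e₂) - H (k⁻¹ • v + e₂) (s • v + e₁)
      = s * H v e₂ - s * H e₂ v + (H e₁ (k⁻¹ • v + e₂) - H (k⁻¹ • v + e₂) e₁) := by
    simp only [map_add, map_smul, add_apply, smul_apply,
      smul_eq_mul]
    ring
  have hk2 : (1:ℝ) / k ^ 2 ≤ 1 / k := by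
    apply one_div_le_one_div_of_le hk0; nlinarith
  have hk1 : (1:ℝ) / k ≤ 1 := by rw [div_le_one hk0]; exact hk
  have hd : ‖k⁻¹ • v + e₂‖ ≤ 3 * ‖v‖ := by
    calc ‖k⁻¹ • v + e₂‖ ≤ ‖k⁻¹ • v‖ + ‖e₂‖ := norm_add_le _ _
      _ ≤ 1 / k * ‖v‖ + 2 / k ^ 2 * ‖v‖ := by
          rw [norm_smul, Real.norm_of_nonneg (by positivity), one_div]; gcongr
      _ = (1 / k + 2 * (1 / k ^ 2)) * ‖v‖ := by ring
      _ ≤ 3 * ‖v‖ := by gcongr; linarith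
  have b : ∀ x y : V, |H x y| ≤ ‖H‖ * ‖x‖ * ‖y‖ := fun x y => H.le_opNorm₂ x y
  have h1 : |s * H v e₂| ≤ ‖H‖ * ‖v‖ * (2 / k ^ 2 * ‖v‖) := by
    rw [abs_mul, abs_of_nonneg hs0]
    calc s * |H v e₂| ≤ 1 * (‖H‖ * ‖v‖ * ‖e₂‖) := by
          apply mul_le_mul hs1 (b _ _) (abs_nonneg _) zero_le_one
      _ ≤ _ := by rw [one_mul]; gcongr
  have h2 : |s * H e₂ v| ≤ ‖H‖ * ‖v‖ * (2 / k ^ 2 * ‖v‖) := by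
    rw [abs_mul, abs_of_nonneg hs0]
    calc s * |H e₂ v| ≤ 1 * (‖H‖ * ‖e₂‖ * ‖v‖) := by
          apply mul_le_mul hs1 (b _ _) (abs_nonneg _) zero_le_one
      _ = ‖H‖ * ‖v‖ * ‖e₂‖ := by ring
      _ ≤ _ := by gcongr
  have h3 : |H e₁ (k⁻¹ • v + e₂)| ≤ ‖H‖ * (1 / k ^ 2 * ‖v‖) * (3 * ‖v‖) :=
    (b _ _).trans (by gcongr)
  have h4 : |H (k⁻¹ • v + e₂) e₁| ≤ ‖H‖ * (3 * ‖v‖) * (1 / k ^ 2 * ‖v‖) :=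
    (b _ _).trans (by gcongr)
  rw [hid]
  have e : 10 * ‖H‖ / k ^ 2 * ‖v‖ ^ 2 = ‖H‖ * ‖v‖ * (2 / k ^ 2 * ‖v‖)
      + ‖H‖ * ‖v‖ * (2 / k ^ 2 * ‖v‖) + ‖H‖ * (1 / k ^ 2 * ‖v‖) * (3 * ‖v‖)
      + ‖H‖ * (3 * ‖v‖) * (1 / k ^ 2 * ‖v‖) := by ring
  rw [e]
  rw [abs_le] at *
  constructor <;> linarith [h1.1, h1.2, h2.1, h2.2, h3.1, h3.2, h4.1, h4.2]

/-- If `G` has uniform two-sided first order expansions with slopes `P` at the points of `A`,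
if `P` is differentiable at `x` within `A`, and if `A` is asymptotically dense at `x`, then `G` has
a second order expansion at `x`. -/
lemma second_order_expansion_of_slopes {G : V → ℝ} {A K : Set V} {P : V → V →L[ℝ] ℝ}
    {H : V →L[ℝ] V →L[ℝ] ℝ} {C : ℝ} {x : V} (hC : 0 ≤ C)
    (hexp : ∀ y ∈ A, ∀ z ∈ K, |G z - G y - P y (z - y)| ≤ C * ‖z - y‖ ^ 2)
    (hAK : A ⊆ K) (hK : K ∈ 𝓝 x) (hP : HasFDerivWithinAt P H A x)
    (hdens : ∀ δ > 0, ∀ᶠ z in 𝓝 x, ∃ y ∈ A, ‖y - z‖ ≤ δ * ‖z - x‖) :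
    ∀ ε > 0, ∀ᶠ v in 𝓝 (0 : V),
      |G (x + v) - G x - P x v - 1 / 2 * H v v| ≤ ε * ‖v‖ ^ 2 := by
  intro ε hε
  set M : ℝ := 9 * C + 10 * ‖H‖ with hM
  have hM0 : 0 ≤ M := by positivity
  obtain ⟨k, hk⟩ := exists_nat_ge (2 * M / ε + 1)
  have hk1 : (1 : ℝ) ≤ k := by
    have : 0 ≤ 2 * M / ε := by positivity
    linarith
  have hk0 : (0 : ℝ) < k := by linarith
  have hMk : M / k ≤ ε / 2 := by
    rw [div_le_iff₀ hk0]
    have : 2 * M / ε ≤ k := by linarith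
    rw [div_le_iff₀ hε] at this
    linarith
  set δ : ℝ := 1 / (k : ℝ) ^ 2 with hδ
  have hδ0 : 0 < δ := by positivity
  have hδk : δ ≤ 1 / k := by
    apply one_div_le_one_div_of_le hk0; nlinarith
  have hk1' : (1 : ℝ) / k ≤ 1 := by rw [div_le_one hk0]; exact hk1
  have hε' : 0 < ε / 12 := by positivity
  have hPd : ∀ᶠ y in 𝓝 x, y ∈ A → ‖P y - P x - H (y - x)‖ ≤ ε / 12 * ‖y - x‖ := by
    have := (hasFDerivWithinAt_iff_isLittleO.1 hP).def hε'
    exact eventually_nhdsWithin_iff.1 this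
  obtain ⟨σ, hσ, hball⟩ := Metric.eventually_nhds_iff.1 ((hPd.and (hdens δ hδ0)).and hK)
  refine Metric.eventually_nhds_iff.2 ⟨σ / 2, by positivity, fun v hv => ?_⟩
  rw [dist_zero_right] at hv
  -- the chain of points
  have hz : ∀ i : ℕ, i ≤ k → ∃ y ∈ A, ‖y - (x + ((i : ℝ) / k) • v)‖ ≤ δ * ((i : ℝ) / k * ‖v‖) := by
    intro i hi
    have hik : (i : ℝ) / k ≤ 1 := by rw [div_le_one hk0]; exact_mod_cast hi
    have hn : ‖((i : ℝ) / k) • v‖ = (i : ℝ) / k * ‖v‖ := by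
      rw [norm_smul, Real.norm_of_nonneg (by positivity)]
    have hd : dist (x + ((i : ℝ) / k) • v) x < σ := by
      rw [dist_eq_norm, add_sub_cancel_left, hn]
      nlinarith [norm_nonneg v]
    obtain ⟨y, hy, hyz⟩ := (hball hd).1.2
    refine ⟨y, hy, ?_⟩
    rwa [add_sub_cancel_left, hn] at hyz
  choose! y hyA hyz using hz
  set Y : ℕ → V := fun i => if i < k then y i else x + v with hY
  have hYz : ∀ i ≤ k, ‖Y i - (x + ((i : ℝ) / k) • v)‖ ≤ δ * ‖v‖ := by
    intro i hi
    by_cases h : i < k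
    · simp only [hY, h, if_true]
      refine (hyz i hi).trans ?_
      have hik : (i : ℝ) / k ≤ 1 := by rw [div_le_one hk0]; exact_mod_cast hi
      gcongr
      nlinarith [norm_nonneg v]
    · have : i = k := by omega
      subst this
      simp only [hY, lt_irrefl, if_false]
      rw [div_self hk0.ne', one_smul, sub_self, norm_zero]; positivity
  have hYA : ∀ i < k, Y i ∈ A := by
    intro i hi; simp only [hY, hi, if_true]; exact hyA i hi.le
  have hY0 : Y 0 = x := by
    have h0 : 0 < k := by exact_mod_cast hk0
    have := hyz 0 h0.le
    simp only [hY, h0, if_true]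
    simp only [Nat.cast_zero, zero_div, zero_smul, add_zero, zero_mul, mul_zero] at this
    exact sub_eq_zero.1 (norm_le_zero_iff.1 this)
  have hYk : Y k = x + v := by simp [hY]
  have hxvK : x + v ∈ K := by
    have hd : dist (x + v) x < σ := by
      rw [dist_eq_norm, add_sub_cancel_left]; linarith
    exact (hball hd).2
  have hYK : ∀ i ≤ k, Y i ∈ K := by
    intro i hi
    rcases hi.lt_or_eq with h | h
    · exact hAK (hYA i h)
    · rw [h, hYk]; exact hxvK
  set R : V → ℝ := fun z => G z - G x - P x (z - x) - 1 / 2 * H (z - x) (z - x) with hR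
  have hstep : ∀ i < k, |R (Y (i + 1)) - R (Y i)| ≤ (M / k ^ 2 + ε / 2 / k) * ‖v‖ ^ 2 := by
    intro i hi
    set s : ℝ := (i : ℝ) / k with hs
    have hs0 : 0 ≤ s := by positivity
    have hs1 : s ≤ 1 := by rw [hs, div_le_one hk0]; exact_mod_cast hi.le
    set e₁ : V := Y i - (x + s • v) with he₁
    set e₂ : V := (Y (i + 1) - (x + (((i + 1 : ℕ) : ℝ) / k) • v)) - e₁ with he₂
    have hs' : (((i + 1 : ℕ) : ℝ) / k) = s + (k : ℝ)⁻¹ := by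
      rw [hs]; push_cast; field_simp
    have ha : Y i - x = s • v + e₁ := by rw [he₁]; abel
    have hd : Y (i + 1) - Y i = (k : ℝ)⁻¹ • v + e₂ := by
      rw [he₂, he₁, hs', add_smul]; abel
    have hb₁ : ‖e₁‖ ≤ 1 / (k : ℝ) ^ 2 * ‖v‖ := hYz i hi.le
    have hb₂ : ‖e₂‖ ≤ 2 / (k : ℝ) ^ 2 * ‖v‖ := by
      calc ‖e₂‖ ≤ _ := norm_sub_le _ _
        _ ≤ δ * ‖v‖ + δ * ‖v‖ := add_le_add (hYz (i + 1) hi) (hYz i hi.le)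
        _ = 2 / (k : ℝ) ^ 2 * ‖v‖ := by rw [hδ]; ring
    have hna : ‖Y i - x‖ ≤ 2 * ‖v‖ := by
      rw [ha]
      calc _ ≤ ‖s • v‖ + ‖e₁‖ := norm_add_le _ _
        _ ≤ 1 * ‖v‖ + 1 * ‖v‖ := by
          rw [norm_smul, Real.norm_of_nonneg hs0]
          refine add_le_add (by gcongr) (hb₁.trans ?_)
          gcongr; exact hδk.trans hk1'
        _ = _ := by ring
    have hnd : ‖Y (i + 1) - Y i‖ ≤ 3 / k * ‖v‖ := by
      rw [hd]
      calc _ ≤ ‖(k : ℝ)⁻¹ • v‖ + ‖e₂‖ := norm_add_le _ _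
        _ ≤ 1 / k * ‖v‖ + 2 * (1 / k) * ‖v‖ := by
          rw [norm_smul, Real.norm_of_nonneg (by positivity), one_div]
          refine add_le_add le_rfl (hb₂.trans ?_)
          rw [← one_div]
          have : (2:ℝ) / k ^ 2 = 2 * δ := by rw [hδ]; ring
          rw [this]; gcongr
        _ = _ := by ring
    have hdist : dist (Y i) x < σ := by
      rw [dist_eq_norm]; linarith
    have hp := (hball hdist).1.1 (hYA i hi)
    have t1 := hexp (Y i) (hYA i hi) (Y (i + 1)) (hYK (i + 1) hi)
    have t2 : |(P (Y i) - P x - H (Y i - x)) (Y (i + 1) - Y i)|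
        ≤ ε / 12 * (2 * ‖v‖) * (3 / k * ‖v‖) := by
      refine (ContinuousLinearMap.le_opNorm (P (Y i) - P x - H (Y i - x)) _).trans ?_
      refine mul_le_mul (hp.trans (by gcongr)) hnd (norm_nonneg _) (by positivity)
    have t3 := chain_step_antisymm_bound H v e₁ e₂ hs0 hs1 hk1 hb₁ hb₂
    rw [← ha, ← hd] at t3
    have t4 : |H (Y (i + 1) - Y i) (Y (i + 1) - Y i)| ≤ ‖H‖ * (3 / k * ‖v‖) * (3 / k * ‖v‖) :=
      (H.le_opNorm₂ _ _).trans (by gcongr)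
    have t1' : |G (Y (i + 1)) - G (Y i) - P (Y i) (Y (i + 1) - Y i)| ≤ C * (3 / k * ‖v‖) ^ 2 :=
      t1.trans (by gcongr)
    have hid : R (Y (i + 1)) - R (Y i) = (G (Y (i + 1)) - G (Y i) - P (Y i) (Y (i + 1) - Y i))
        + (P (Y i) - P x - H (Y i - x)) (Y (i + 1) - Y i)
        + 1 / 2 * (H (Y i - x) (Y (i + 1) - Y i) - H (Y (i + 1) - Y i) (Y i - x))
        - 1 / 2 * H (Y (i + 1) - Y i) (Y (i + 1) - Y i) := by
      have e : Y (i + 1) - x = (Y i - x) + (Y (i + 1) - Y i) := by abel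
      simp only [hR]
      rw [e]
      simp only [map_add, add_apply, sub_apply]
      ring
    have htot : (M / k ^ 2 + ε / 2 / k) * ‖v‖ ^ 2 = C * (3 / k * ‖v‖) ^ 2
        + ε / 12 * (2 * ‖v‖) * (3 / k * ‖v‖) + 1 / 2 * (10 * ‖H‖ / k ^ 2 * ‖v‖ ^ 2)
        + 1 / 2 * (10 * ‖H‖ / k ^ 2 * ‖v‖ ^ 2) := by
      rw [hM]; field_simp; ring
    have hlast : ‖H‖ * (3 / k * ‖v‖) * (3 / k * ‖v‖) ≤ 10 * ‖H‖ / k ^ 2 * ‖v‖ ^ 2 := by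
      have : ‖H‖ * (3 / k * ‖v‖) * (3 / k * ‖v‖) = 9 * (‖H‖ / k ^ 2 * ‖v‖ ^ 2) := by ring
      rw [this]
      have : 10 * ‖H‖ / k ^ 2 * ‖v‖ ^ 2 = 10 * (‖H‖ / k ^ 2 * ‖v‖ ^ 2) := by ring
      rw [this]
      have : 0 ≤ ‖H‖ / k ^ 2 * ‖v‖ ^ 2 := by positivity
      linarith
    rw [hid, htot]
    rw [abs_le] at *
    constructor <;> linarith [t1'.1, t1'.2, t2.1, t2.2, t3.1, t3.2, t4.1, t4.2]
  have hsum : ∀ i ≤ k, |R (Y i)| ≤ i * ((M / k ^ 2 + ε / 2 / k) * ‖v‖ ^ 2) := by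
    intro i
    induction i with
    | zero => intro _; simp [hR, hY0]
    | succ j ih =>
      intro hj
      have h1 := ih (by omega)
      have h2 := hstep j (by omega)
      push_cast
      have : R (Y (j + 1)) = (R (Y (j + 1)) - R (Y j)) + R (Y j) := by ring
      rw [this]
      refine (abs_add_le _ _).trans ?_
      linarith
  have hfin := hsum k le_rfl
  rw [hYk] at hfin
  simp only [hR, add_sub_cancel_left] at hfin
  refine hfin.trans ?_
  rw [← mul_assoc]
  gcongr
  have : (k : ℝ) * (M / k ^ 2 + ε / 2 / k) = M / k + ε / 2 := by field_simp
  rw [this]; linarith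

end SecondOrder

section Jensen

open Filter Topology Module

variable {V : Type*} [NormedAddCommGroup V] [NormedSpace ℝ V]

/-- `G` is touched from below at every point by a paraboloid of opening `C`. -/
def LowerParaboloid (G : V → ℝ) (C : ℝ) : Prop :=
  ∀ x, ∃ s : V →L[ℝ] ℝ, ∀ y, G x + s (y - x) - C * ‖y - x‖ ^ 2 ≤ G y

lemma LowerParaboloid.lower_bound_of_touching {G : V → ℝ} {C : ℝ} (hG : LowerParaboloid G C)
    {K : Set V} {x : V} (hK : K ∈ 𝓝 x) {p : V →L[ℝ] ℝ}
    (hp : ∀ y ∈ K, G y ≤ G x + p (y - x)) (y : V) :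
    G x + p (y - x) - C * ‖y - x‖ ^ 2 ≤ G y := by
  obtain ⟨s, hs⟩ := hG x
  have hle : ∀ d : V, s d ≤ p d := by
    intro d
    have hlim : Tendsto (fun t : ℝ => x + t • d) (𝓝[>] 0) (𝓝 x) := by
      have : Tendsto (fun t : ℝ => x + t • d) (𝓝 0) (𝓝 (x + (0 : ℝ) • d)) :=
        (Continuous.tendsto (by fun_prop) 0)
      rw [zero_smul, add_zero] at this
      exact this.mono_left nhdsWithin_le_nhds
    have hev : ∀ᶠ t : ℝ in 𝓝[>] 0, s d - C * t * ‖d‖ ^ 2 ≤ p d := by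
      filter_upwards [hlim hK, self_mem_nhdsWithin] with t ht ht0
      have ht0 : 0 < t := ht0
      have h1 := hs (x + t • d)
      have h2 := hp _ ht
      rw [add_sub_cancel_left, map_smul, smul_eq_mul] at h1 h2
      rw [norm_smul, Real.norm_of_nonneg ht0.le] at h1
      have : t * (s d - C * t * ‖d‖ ^ 2) ≤ t * p d := by nlinarith
      exact le_of_mul_le_mul_left this ht0
    have hl : Tendsto (fun t : ℝ => s d - C * t * ‖d‖ ^ 2) (𝓝[>] 0) (𝓝 (s d)) := by
      have : Tendsto (fun t : ℝ => s d - C * t * ‖d‖ ^ 2) (𝓝 0)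
          (𝓝 (s d - C * (0 : ℝ) * ‖d‖ ^ 2)) := Continuous.tendsto (by fun_prop) 0
      simp only [mul_zero, zero_mul, sub_zero] at this
      exact this.mono_left nhdsWithin_le_nhds
    exact le_of_tendsto hl hev
  have heq : s (y - x) = p (y - x) := by
    apply le_antisymm (hle _)
    have := hle (-(y - x))
    rw [map_neg, map_neg] at this
    linarith
  rw [← heq]
  exact hs y

/-- Comparison of the slopes of two touching hyperplanes. -/
lemma LowerParaboloid.slope_sub_opNorm_le {G : V → ℝ} {C : ℝ} (hG : LowerParaboloid G C)
    (hC : 0 ≤ C) {c : V} {r : ℝ} {x x' : V} (hx : x ∈ ball c (r / 4)) (hx' : x' ∈ ball c (r / 4))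
    {p p' : V →L[ℝ] ℝ}
    (hp : ∀ y ∈ closedBall c r, G y ≤ G x + p (y - x))
    (hp' : ∀ y ∈ closedBall c r, G y ≤ G x' + p' (y - x')) :
    ‖p - p'‖ ≤ 4 * C * ‖x - x'‖ := by
  have hr : 0 < r := by
    have := dist_nonneg.trans_lt (mem_ball.1 hx); linarith
  have hmem : ∀ z, dist z c ≤ r → z ∈ closedBall c r := fun z h => h
  have hnx : closedBall c r ∈ 𝓝 x :=
    closedBall_mem_nhds_of_mem (ball_subset_ball (by linarith) hx)
  have hlow := hG.lower_bound_of_touching hnx hp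
  rw [mem_ball] at hx hx'
  have key : ∀ z ∈ closedBall c r, (p - p') (z - x') ≤ C * ‖z - x‖ ^ 2 := by
    intro z hz
    have h1 := hlow z
    have h2 := hp' z hz
    have h3 := hp x' (hmem _ (by linarith))
    have e : p (z - x) = p (z - x') + p (x' - x) := by rw [← map_add]; congr 1; abel
    rw [sub_apply]
    linarith
  have hdist : dist x x' < r / 2 := by
    have := dist_triangle_right x x' c; linarith
  rw [dist_eq_norm] at hdist
  rcases eq_or_ne x x' with hxx | hxx
  · subst hxx
    have h0 : ∀ d, (p - p') d ≤ 0 := by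
      intro d
      have hev : ∀ᶠ t : ℝ in 𝓝[>] 0, (p - p') d ≤ C * t * ‖d‖ ^ 2 := by
        have hlim : Tendsto (fun t : ℝ => x + t • d) (𝓝[>] 0) (𝓝 x) := by
          have : Tendsto (fun t : ℝ => x + t • d) (𝓝 0) (𝓝 (x + (0 : ℝ) • d)) :=
            (Continuous.tendsto (by fun_prop) 0)
          rw [zero_smul, add_zero] at this
          exact this.mono_left nhdsWithin_le_nhds
        filter_upwards [hlim hnx, self_mem_nhdsWithin] with t ht ht0
        have ht0 : 0 < t := ht0
        have h1 := key _ ht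
        rw [add_sub_cancel_left, map_smul, smul_eq_mul, norm_smul,
          Real.norm_of_nonneg ht0.le] at h1
        have : t * (p - p') d ≤ t * (C * t * ‖d‖ ^ 2) := by nlinarith
        exact le_of_mul_le_mul_left this ht0
      have hl : Tendsto (fun t : ℝ => C * t * ‖d‖ ^ 2) (𝓝[>] 0) (𝓝 0) := by
        have : Tendsto (fun t : ℝ => C * t * ‖d‖ ^ 2) (𝓝 0) (𝓝 (C * (0 : ℝ) * ‖d‖ ^ 2)) :=
          Continuous.tendsto (by fun_prop) 0
        simp only [mul_zero, zero_mul] at this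
        exact this.mono_left nhdsWithin_le_nhds
      exact ge_of_tendsto hl hev
    have : p - p' = 0 := by
      ext d
      apply le_antisymm (h0 d)
      have := h0 (-d)
      rw [map_neg] at this
      simpa using this
    rw [this, sub_self, norm_zero, norm_zero, mul_zero]
  · set s := ‖x - x'‖ with hs
    have hs0 : 0 < s := norm_pos_iff.2 (sub_ne_zero.2 hxx)
    have hup : ∀ d : V, (p - p') d ≤ 4 * C * s * ‖d‖ := by
      intro d
      rcases eq_or_ne d 0 with hd | hd
      · subst hd; simp
      have hd0 : 0 < ‖d‖ := norm_pos_iff.2 hd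
      have hnorm : ‖(s / ‖d‖) • d‖ = s := by
        rw [norm_smul, Real.norm_of_nonneg (by positivity), div_mul_cancel₀ _ hd0.ne']
      have hz : x' + (s / ‖d‖) • d ∈ closedBall c r := by
        apply hmem
        have := dist_triangle (x' + (s / ‖d‖) • d) x' c
        rw [dist_eq_norm (x' + (s / ‖d‖) • d) x', add_sub_cancel_left, hnorm] at this
        linarith
      have h := key _ hz
      rw [add_sub_cancel_left, map_smul, smul_eq_mul] at h
      have hn : ‖x' + (s / ‖d‖) • d - x‖ ≤ 2 * s := by
        have e : x' + (s / ‖d‖) • d - x = (s / ‖d‖) • d - (x - x') := by abel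
        rw [e]
        refine (norm_sub_le _ _).trans ?_
        rw [hnorm]; linarith
      have h' : s / ‖d‖ * (p - p') d ≤ C * (2 * s) ^ 2 := h.trans (by gcongr)
      have : s / ‖d‖ * (p - p') d ≤ s / ‖d‖ * (4 * C * s * ‖d‖) := by
        refine h'.trans (le_of_eq ?_)
        field_simp; ring
      exact le_of_mul_le_mul_left this (by positivity)
    refine ContinuousLinearMap.opNorm_le_bound _ (by positivity) fun d => ?_
    rw [Real.norm_eq_abs, abs_le]
    refine ⟨?_, hup d⟩
    have := hup (-d)
    rw [map_neg, norm_neg] at this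
    linarith

lemma eventually_exists_near_of_density [FiniteDimensional ℝ V] [MeasurableSpace V] [BorelSpace V]
    (μ : Measure V) [μ.IsAddHaarMeasure] {A : Set V} {x : V}
    (hx : Tendsto (fun r => μ (A ∩ closedBall x r) / μ (closedBall x r)) (𝓝[>] 0) (𝓝 1))
    (hxA : x ∈ A) {δ : ℝ} (hδ : 0 < δ) :
    ∀ᶠ z in 𝓝 x, ∃ y ∈ A, ‖y - z‖ ≤ δ * ‖z - x‖ := by
  wlog hδ1 : δ ≤ 1 generalizing δ
  · filter_upwards [this zero_lt_one le_rfl] with z hz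
    obtain ⟨y, hy, hyz⟩ := hz
    exact ⟨y, hy, hyz.trans (by gcongr; exact (not_le.1 hδ1).le)⟩
  set N := finrank ℝ V
  have hlt : 1 - ENNReal.ofReal ((δ / 2) ^ N) < 1 := by
    apply ENNReal.sub_lt_self ENNReal.one_ne_top one_ne_zero
    rw [Ne, ENNReal.ofReal_eq_zero, not_le]; positivity
  have hev := hx.eventually (lt_mem_nhds hlt)
  rw [eventually_nhdsWithin_iff, Metric.eventually_nhds_iff] at hev
  obtain ⟨σ, hσ, hball⟩ := hev
  refine Metric.eventually_nhds_iff.2 ⟨σ / 2, by positivity, fun z hz => ?_⟩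
  rcases eq_or_ne z x with hzx | hzx
  · subst hzx; exact ⟨z, hxA, by simp⟩
  by_contra! hcon
  rw [dist_eq_norm] at hz
  set s := ‖z - x‖ with hs
  have hs0 : 0 < s := norm_pos_iff.2 (sub_ne_zero.2 hzx)
  have h2s := hball (y := 2 * s) (by rw [dist_zero_right, Real.norm_of_nonneg (by positivity)]; linarith)
    (by show 0 < 2 * s; positivity)
  have hsub : A ∩ closedBall x (2 * s) ⊆ closedBall x (2 * s) \ closedBall z (δ * s) := by
    rintro y ⟨hyA, hyx⟩
    refine ⟨hyx, fun hyz => ?_⟩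
    have := hcon y hyA
    rw [mem_closedBall, dist_eq_norm] at hyz
    linarith
  have hsub2 : closedBall z (δ * s) ⊆ closedBall x (2 * s) := by
    apply closedBall_subset_closedBall'
    rw [dist_eq_norm, ← hs]
    nlinarith
  have hle : μ (A ∩ closedBall x (2 * s)) ≤ μ (closedBall x (2 * s)) - μ (closedBall z (δ * s)) := by
    refine (measure_mono hsub).trans (le_of_eq ?_)
    exact measure_sdiff hsub2 measurableSet_closedBall.nullMeasurableSet
      measure_closedBall_lt_top.ne
  have hB : μ (closedBall z (δ * s)) = ENNReal.ofReal ((δ / 2) ^ N) * μ (closedBall x (2 * s)) := by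
    rw [μ.addHaar_closedBall z (by positivity), μ.addHaar_closedBall x (by positivity), ← mul_assoc,
      ← ENNReal.ofReal_mul (by positivity), ← mul_pow]
    rw [show δ / 2 * (2 * s) = δ * s by ring]
  have hpos : μ (closedBall x (2 * s)) ≠ 0 := (measure_closedBall_pos μ x (by positivity)).ne'
  have hfin : μ (closedBall x (2 * s)) ≠ ⊤ := measure_closedBall_lt_top.ne
  have : μ (A ∩ closedBall x (2 * s)) / μ (closedBall x (2 * s))
      ≤ 1 - ENNReal.ofReal ((δ / 2) ^ N) := by
    rw [ENNReal.div_le_iff hpos hfin, ENNReal.sub_mul (fun _ _ => hfin), one_mul, ← hB]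
    exact hle
  exact absurd h2s (not_lt.2 this)

/-- A Jensen-type maximum principle: near a strict maximum of a function touched from below by
paraboloids there is a point touched from above by a hyperplane at which the function has a second
order expansion. -/
theorem LowerParaboloid.exists_touching_second_order [FiniteDimensional ℝ V] {G : V → ℝ} {C : ℝ}
    (hG : LowerParaboloid G C) (hC : 0 ≤ C) {c : V} {r η : ℝ} (hr : 0 < r) (hη : 0 < η)
    (hstrict : ∀ x ∈ closedBall c r, r / 4 ≤ ‖x - c‖ → G x + η ≤ G c)
    (hmax : ∀ p : V →L[ℝ] ℝ, ∃ x ∈ closedBall c r, ∀ y ∈ closedBall c r, G y - p y ≤ G x - p x) :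
    ∃ x ∈ ball c (r / 4), ∃ (p : V →L[ℝ] ℝ) (H : V →L[ℝ] V →L[ℝ] ℝ),
      (∀ y ∈ closedBall c r, G y ≤ G x + p (y - x)) ∧
      ∀ ε > 0, ∀ᶠ v in 𝓝 (0 : V), |G (x + v) - G x - p v - 1 / 2 * H v v| ≤ ε * ‖v‖ ^ 2 := by
  borelize V
  borelize (V →L[ℝ] ℝ)
  set A : Set V := {x | x ∈ ball c (r / 4) ∧
    ∃ p : V →L[ℝ] ℝ, ∀ y ∈ closedBall c r, G y ≤ G x + p (y - x)} with hA
  have hA2 : ∀ x ∈ A, ∃ p : V →L[ℝ] ℝ, ∀ y ∈ closedBall c r, G y ≤ G x + p (y - x) :=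
    fun x hx => hx.2
  choose! P hP using hA2
  have hlip : LipschitzOnWith (4 * C).toNNReal P A := by
    refine LipschitzOnWith.of_dist_le_mul fun x hx y hy => ?_
    rw [dist_eq_norm, dist_eq_norm, Real.coe_toNNReal _ (by positivity)]
    exact hG.slope_sub_opNorm_le hC hx.1 hy.1 (hP x hx) (hP y hy)
  have hsurj : ball (0 : V →L[ℝ] ℝ) (η / r) ⊆ P '' A := by
    intro p hp
    rw [mem_ball_zero_iff, lt_div_iff₀ hr] at hp
    obtain ⟨x, hx, hxmax⟩ := hmax p
    have htouch : ∀ y ∈ closedBall c r, G y ≤ G x + p (y - x) := by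
      intro y hy
      have := hxmax y hy
      rw [map_sub]; linarith
    have hxA : x ∈ A := by
      refine ⟨?_, p, htouch⟩
      by_contra hcon
      rw [mem_ball, not_lt, dist_eq_norm] at hcon
      have h1 := hstrict x hx hcon
      have h2 := htouch c (mem_closedBall_self hr.le)
      have h3 : p (c - x) ≤ ‖p‖ * r := by
        refine (le_abs_self _).trans ((p.le_opNorm _).trans ?_)
        gcongr
        rw [norm_sub_rev, ← dist_eq_norm]; exact hx
      linarith
    refine ⟨x, hxA, ?_⟩
    have := hG.slope_sub_opNorm_le hC hxA.1 hxA.1 (hP x hxA) htouch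
    rw [sub_self, norm_zero, mul_zero, norm_le_zero_iff, sub_eq_zero] at this
    exact this
  set μ : Measure V := Measure.hausdorffMeasure (finrank ℝ V) with hμ
  have hμA : μ A ≠ 0 := by
    intro h0
    have hle := hlip.hausdorffMeasure_image_le (d := (finrank ℝ V : ℝ)) (by positivity)
    rw [← hμ, h0, mul_zero, nonpos_iff_eq_zero] at hle
    have hdim : finrank ℝ (V →L[ℝ] ℝ) = finrank ℝ V := by
      rw [← (LinearMap.toContinuousLinearMap (𝕜 := ℝ) (E := V) (F' := ℝ)).finrank_eq]
      exact Subspace.dual_finrank_eq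
    have hpos : 0 < (Measure.hausdorffMeasure (finrank ℝ V) : Measure (V →L[ℝ] ℝ))
        (ball 0 (η / r)) := by
      rw [← hdim]
      exact measure_ball_pos _ _ (by positivity)
    exact absurd (measure_mono_null hsurj hle) hpos.ne'
  have hdiff := hlip.ae_differentiableWithinAt_of_mem (μ := μ)
  have hdens := ae_imp_of_ae_restrict (Besicovitch.ae_tendsto_measure_inter_div μ A)
  obtain ⟨x, hxA, hxd, hxt⟩ : ∃ x ∈ A, DifferentiableWithinAt ℝ P A x ∧
      Tendsto (fun r => μ (A ∩ closedBall x r) / μ (closedBall x r)) (𝓝[>] 0) (𝓝 1) := by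
    by_contra! hcon
    apply hμA
    have : ∀ᵐ x ∂μ, x ∉ A := by
      filter_upwards [hdiff, hdens] with x h1 h2 h3
      exact hcon x h3 (h1 h3) (h2 h3)
    rw [ae_iff] at this
    simpa using this
  have hnb : ∀ y ∈ A, closedBall c r ∈ 𝓝 y := fun y hy =>
    closedBall_mem_nhds_of_mem (ball_subset_ball (by linarith) hy.1)
  refine ⟨x, hxA.1, P x, fderivWithin ℝ P A x, hP x hxA, ?_⟩
  refine second_order_expansion_of_slopes (K := closedBall c r) hC ?_ ?_ (hnb x hxA)
    hxd.hasFDerivWithinAt (fun δ hδ => eventually_exists_near_of_density μ hxt hxA hδ)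
  · intro y hy z hz
    have h1 := hP y hy z hz
    have h2 := hG.lower_bound_of_touching (hnb y hy) (hP y hy) z
    have : 0 ≤ C * ‖z - y‖ ^ 2 := by positivity
    rw [abs_le]; constructor <;> linarith
  · exact fun y hy => ball_subset_closedBall (ball_subset_ball (by linarith) hy.1)

end Jensen

section SupConvolution

open Filter Topology Module

lemma LowerParaboloid.add {V : Type*} [NormedAddCommGroup V] [NormedSpace ℝ V] {f g : V → ℝ}
    {C D : ℝ} (hf : LowerParaboloid f C) (hg : LowerParaboloid g D) :
    LowerParaboloid (fun x => f x + g x) (C + D) := by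
  intro x
  obtain ⟨s, hs⟩ := hf x
  obtain ⟨t, ht⟩ := hg x
  refine ⟨s + t, fun y => ?_⟩
  have h1 := hs y
  have h2 := ht y
  rw [add_apply]
  linarith

lemma LowerParaboloid.comp_clm {V W : Type*} [NormedAddCommGroup V] [NormedSpace ℝ V]
    [NormedAddCommGroup W] [NormedSpace ℝ W] {f : W → ℝ} {C : ℝ} (hf : LowerParaboloid f C)
    (hC : 0 ≤ C) (D : V →L[ℝ] W) (hD : ∀ v, ‖D v‖ ≤ ‖v‖) :
    LowerParaboloid (fun x => f (D x)) C := by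
  intro x
  obtain ⟨s, hs⟩ := hf (D x)
  refine ⟨s.comp D, fun y => ?_⟩
  have h1 := hs (D y)
  rw [← map_sub] at h1
  have h2 : C * ‖D (y - x)‖ ^ 2 ≤ C * ‖y - x‖ ^ 2 := by gcongr; exact hD _
  rw [ContinuousLinearMap.comp_apply]
  linarith

lemma lowerParaboloid_neg_quadratic {V : Type*} [NormedAddCommGroup V] [NormedSpace ℝ V]
    (c : V) (l : V →L[ℝ] ℝ) (B : V →L[ℝ] V →L[ℝ] ℝ) :
    LowerParaboloid (fun v => -(l (v - c) + 1 / 2 * B (v - c) (v - c))) (1 / 2 * ‖B‖) := by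
  intro x
  refine ⟨-(l + (1 / 2 : ℝ) • (B (x - c) + B.flip (x - c))), fun y => ?_⟩
  have e : y - c = (x - c) + (y - x) := by abel
  have hb : B (y - x) (y - x) ≤ ‖B‖ * ‖y - x‖ ^ 2 := by
    refine (le_abs_self _).trans ((B.le_opNorm₂ _ _).trans (le_of_eq (by ring)))
  simp only [neg_apply, add_apply, smul_apply, smul_eq_mul, ContinuousLinearMap.flip_apply]
  rw [e]
  simp only [map_add, add_apply]
  linarith

variable {E : Type*} [NormedAddCommGroup E] [InnerProductSpace ℝ E]

lemma lowerParaboloid_supConvolution {W : E → ℝ} {K : Set E} {N : ℝ} {α : E → E}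
    (hα : ∀ x, α x ∈ K ∧ ∀ a ∈ K, W a - N * ‖x - a‖ ^ 2 ≤ W (α x) - N * ‖x - α x‖ ^ 2) :
    LowerParaboloid (fun x => W (α x) - N * ‖x - α x‖ ^ 2) N := by
  intro x
  refine ⟨(-2 * N) • innerSL ℝ (x - α x), fun y => ?_⟩
  have h := (hα y).2 (α x) (hα x).1
  have e : y - α x = (x - α x) + (y - x) := by abel
  have e2 : ‖y - α x‖ ^ 2 = ‖x - α x‖ ^ 2 + 2 * ⟪x - α x, y - x⟫ + ‖y - x‖ ^ 2 := by
    rw [e, norm_add_sq_real]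
  rw [smul_apply, innerSL_apply_apply, smul_eq_mul]
  rw [e2] at h
  linarith

lemma exists_supConvolution_argmax [FiniteDimensional ℝ E] {W : E → ℝ} {c : E} {r : ℝ}
    (hr : 0 ≤ r) (hW : ContinuousOn W (closedBall c r)) (N : ℝ) :
    ∃ α : E → E, ∀ x, α x ∈ closedBall c r ∧
      ∀ a ∈ closedBall c r, W a - N * ‖x - a‖ ^ 2 ≤ W (α x) - N * ‖x - α x‖ ^ 2 := by
  have : ∀ x, ∃ b ∈ closedBall c r,
      ∀ a ∈ closedBall c r, W a - N * ‖x - a‖ ^ 2 ≤ W b - N * ‖x - b‖ ^ 2 := by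
    intro x
    have hc : ContinuousOn (fun a => W a - N * ‖x - a‖ ^ 2) (closedBall c r) :=
      hW.sub (Continuous.continuousOn (by fun_prop))
    exact (isCompact_closedBall c r).exists_isMaxOn ⟨c, mem_closedBall_self hr⟩ hc
  choose α hα using this
  exact ⟨α, hα⟩

/-- If `f` touches the sup-convolution of `W` appropriately, the touching transfers to `W`. -/
lemma supConvolution_touching {E : Type*} [NormedAddCommGroup E] {W : E → ℝ} {K : Set E} {N : ℝ} {α : E → E}
    (hα : ∀ x, α x ∈ K ∧ ∀ a ∈ K, W a - N * ‖x - a‖ ^ 2 ≤ W (α x) - N * ‖x - α x‖ ^ 2)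
    {x : E} (hx : K ∈ 𝓝 (α x)) {g : E → ℝ}
    (hg : ∀ᶠ h in 𝓝 (0 : E), (W (α (x + h)) - N * ‖x + h - α (x + h)‖ ^ 2)
      ≤ (W (α x) - N * ‖x - α x‖ ^ 2) + g h) :
    ∀ᶠ h in 𝓝 (0 : E), W (α x + h) ≤ W (α x) + g h := by
  have hK : ∀ᶠ h in 𝓝 (0 : E), α x + h ∈ K := by
    have : Tendsto (fun h : E => α x + h) (𝓝 0) (𝓝 (α x + 0)) :=
      Continuous.tendsto (by fun_prop) 0
    rw [add_zero] at this
    exact this hx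
  filter_upwards [hK, hg] with h h1 h2
  have h3 := (hα (x + h)).2 _ h1
  have e : x + h - (α x + h) = x - α x := by abel
  rw [e] at h3
  linarith

lemma dist_supConvolution_argmax_lt {E : Type*} [NormedAddCommGroup E] {W : E → ℝ} {c : E}
    {r N M : ℝ} {α : E → E} (hr : 0 < r)
    (hα : ∀ x, α x ∈ closedBall c r ∧ ∀ a ∈ closedBall c r,
      W a - N * ‖x - a‖ ^ 2 ≤ W (α x) - N * ‖x - α x‖ ^ 2)
    (hM : ∀ x ∈ closedBall c r, ‖W x‖ ≤ M) (hN : 2 * M < N * (r / 2) ^ 2) {x : E}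
    (hx : x ∈ ball c (r / 4)) : α x ∈ ball c r := by
  have hxK : x ∈ closedBall c r := ball_subset_closedBall (ball_subset_ball (by linarith) hx)
  have h := (hα x).2 x hxK
  have h1 := abs_le.1 (hM x hxK)
  have h2 := abs_le.1 (hM _ (hα x).1)
  rw [sub_self, norm_zero] at h
  have hM0 : 0 ≤ M := (norm_nonneg _).trans (hM x hxK)
  have hN0 : 0 < N := by
    by_contra hcon
    have : N * (r / 2) ^ 2 ≤ 0 := mul_nonpos_of_nonpos_of_nonneg (not_lt.1 hcon) (by positivity)
    linarith
  have hlt : ‖x - α x‖ < r / 2 := by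
    by_contra hcon
    have h3 : (r / 2) ^ 2 ≤ ‖x - α x‖ ^ 2 := by
      have := not_lt.1 hcon
      gcongr
    have : N * (r / 2) ^ 2 ≤ N * ‖x - α x‖ ^ 2 := by gcongr
    linarith [h1.1, h2.2]
  rw [mem_ball] at *
  rw [← dist_eq_norm] at hlt
  have := dist_triangle_left (α x) c x
  linarith

variable {V : Type*} [NormedAddCommGroup V] [NormedSpace ℝ V]

lemma quadratic_sub_le {l : V →L[ℝ] ℝ} {B : V →L[ℝ] V →L[ℝ] ℝ} {x y : V} {r : ℝ} (hx : ‖x‖ ≤ r)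
    (hy : ‖y‖ ≤ r) :
    l x + 1 / 2 * B x x - (l y + 1 / 2 * B y y) ≤ (‖l‖ + ‖B‖ * r) * ‖x - y‖ := by
  set t : ℝ := ‖x - y‖ with ht
  have ht0 : 0 ≤ t := norm_nonneg _
  have e : l x + 1 / 2 * B x x - (l y + 1 / 2 * B y y)
    = l (x - y) + 1 / 2 * B (x - y) x + 1 / 2 * B y (x - y) := by
    simp only [map_sub, sub_apply]
    ring
  rw [e]
  have h1 : l (x - y) ≤ ‖l‖ * t := (le_abs_self _).trans (l.le_opNorm _)
  have h2 : B (x - y) x ≤ ‖B‖ * t * r :=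
    (le_abs_self _).trans ((B.le_opNorm₂ _ _).trans (by gcongr))
  have h3 : B y (x - y) ≤ ‖B‖ * r * t :=
    (le_abs_self _).trans ((B.le_opNorm₂ _ _).trans (by gcongr))
  linarith

set_option maxHeartbeats 2000000 in
/-- A theorem on sums for quadratic penalisations, on a space `V` split as a product of two copies
of `E` with the maximum norm: if `W₁ + W₂` minus a quadratic polynomial
has a local maximum at `c`, then nearby `W₁` and `W₂` are touched from above by quadratic
polynomials whose Hessians satisfy the joint matrix inequality. -/
theorem exists_quadratic_touching_of_split_sum_max [FiniteDimensional ℝ E] [FiniteDimensional ℝ V]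
    {D₁ D₂ : V →L[ℝ] E} {J₁ J₂ : E →L[ℝ] V} (hD₁n : ∀ v, ‖D₁ v‖ ≤ ‖v‖)
    (hD₂n : ∀ v, ‖D₂ v‖ ≤ ‖v‖) (hnmax : ∀ v, ‖v‖ ≤ max ‖D₁ v‖ ‖D₂ v‖)
    (hDJ₁ : ∀ h k, D₁ (J₁ h + J₂ k) = h) (hDJ₂ : ∀ h k, D₂ (J₁ h + J₂ k) = k)
    {W₁ W₂ : E → ℝ} {c : V}
    {r : ℝ} (hr : 0 < r) (hW₁ : ContinuousOn W₁ (closedBall (D₁ c) r))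
    (hW₂ : ContinuousOn W₂ (closedBall (D₂ c) r)) {l : V →L[ℝ] ℝ}
    {B : V →L[ℝ] V →L[ℝ] ℝ}
    (hmax : ∀ v ∈ closedBall c r, W₁ (D₁ v) + W₂ (D₂ v) ≤ W₁ (D₁ c) + W₂ (D₂ c)
      + l (v - c) + 1 / 2 * B (v - c) (v - c))
    {δ : ℝ} (hδ : 0 < δ) :
    ∃ a ∈ ball (D₁ c) r, ∃ b ∈ ball (D₂ c) r, ∃ (p q : E →L[ℝ] ℝ) (X Y : E →L[ℝ] E →L[ℝ] ℝ),
      (∀ᶠ h in 𝓝 (0 : E), W₁ (a + h) ≤ W₁ a + (p h + 1 / 2 * X h h)) ∧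
      (∀ᶠ h in 𝓝 (0 : E), W₂ (b + h) ≤ W₂ b + (q h + 1 / 2 * Y h h)) ∧
      ∀ h k, X h h + Y k k ≤ B (J₁ h + J₂ k) (J₁ h + J₂ k) + δ * (‖h‖ ^ 2 + ‖k‖ ^ 2) := by
  have hJn₁ : ∀ h, ‖J₁ h‖ ≤ ‖h‖ := fun h => by
    have h1 := hDJ₁ h 0
    have h2 := hDJ₂ h 0
    have h3 := hnmax (J₁ h)
    rw [map_zero, add_zero] at h1 h2
    rwa [h1, h2, norm_zero, max_eq_left (norm_nonneg _)] at h3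
  have hJn₂ : ∀ h, ‖J₂ h‖ ≤ ‖h‖ := fun h => by
    have h1 := hDJ₁ 0 h
    have h2 := hDJ₂ 0 h
    have h3 := hnmax (J₂ h)
    rw [map_zero, zero_add] at h1 h2
    rwa [h1, h2, norm_zero, max_eq_right (norm_nonneg _)] at h3
  have hDJ₁₁ : ∀ h, D₁ (J₁ h) = h := fun h => by simpa using hDJ₁ h 0
  have hDJ₁₂ : ∀ h, D₁ (J₂ h) = 0 := fun h => by simpa using hDJ₁ 0 h
  have hDJ₂₁ : ∀ h, D₂ (J₁ h) = 0 := fun h => by simpa using hDJ₂ h 0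
  have hDJ₂₂ : ∀ h, D₂ (J₂ h) = h := fun h => by simpa using hDJ₂ 0 h
  set c₁ := D₁ c with hc₁
  set c₂ := D₂ c with hc₂
  have hmemD : ∀ v ∈ closedBall c r, D₁ v ∈ closedBall c₁ r ∧ D₂ v ∈ closedBall c₂ r := by
    intro v hv
    rw [mem_closedBall, dist_eq_norm] at hv
    rw [mem_closedBall, dist_eq_norm, mem_closedBall, dist_eq_norm, hc₁, hc₂, ← map_sub, ← map_sub]
    exact ⟨(hD₁n _).trans hv, (hD₂n _).trans hv⟩
  have hmemJ : ∀ a ∈ closedBall c₁ r, ∀ b ∈ closedBall c₂ r, J₁ a + J₂ b ∈ closedBall c r := by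
    intro a ha b hb
    rw [mem_closedBall, dist_eq_norm] at *
    refine (hnmax _).trans (max_le ?_ ?_)
    · rw [map_sub, hDJ₁]; exact ha
    · rw [map_sub, hDJ₂]; exact hb
  obtain ⟨M₁, hM₁⟩ := (isCompact_closedBall c₁ r).exists_bound_of_continuousOn hW₁
  obtain ⟨M₂, hM₂⟩ := (isCompact_closedBall c₂ r).exists_bound_of_continuousOn hW₂
  set Lq : ℝ := ‖l‖ + ‖B‖ * r with hLq
  have hLq0 : 0 ≤ Lq := by positivity
  obtain ⟨N, hN1, hNM1, hNM2, hNL⟩ : ∃ N : ℝ, 1 ≤ N ∧ 2 * M₁ < N * (r / 2) ^ 2 ∧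
      2 * M₂ < N * (r / 2) ^ 2 ∧ Lq ^ 2 ≤ N * (4 * (δ / 4 * r ^ 2 / 32)) := by
    have hev : ∀ᶠ N : ℝ in atTop, 1 ≤ N ∧ 2 * M₁ < N * (r / 2) ^ 2 ∧
      2 * M₂ < N * (r / 2) ^ 2 ∧ Lq ^ 2 ≤ N * (4 * (δ / 4 * r ^ 2 / 32)) := by
      have t1 : Tendsto (fun N : ℝ => N * (r / 2) ^ 2) atTop atTop :=
        tendsto_id.atTop_mul_const (by positivity)
      have t2 : Tendsto (fun N : ℝ => N * (4 * (δ / 4 * r ^ 2 / 32))) atTop atTop :=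
        tendsto_id.atTop_mul_const (by positivity)
      filter_upwards [eventually_ge_atTop 1, t1.eventually_gt_atTop (2 * M₁),
        t1.eventually_gt_atTop (2 * M₂), t2.eventually_ge_atTop (Lq ^ 2)] with N h1 h2 h3 h4
      exact ⟨h1, h2, h3, h4⟩
    exact hev.exists
  have hN0 : 0 < N := by linarith
  obtain ⟨α, hα⟩ := exists_supConvolution_argmax hr.le hW₁ N
  obtain ⟨β, hβ⟩ := exists_supConvolution_argmax hr.le hW₂ N
  set I : V →L[ℝ] V →L[ℝ] ℝ :=
    (innerSL ℝ).bilinearComp D₁ D₁ + (innerSL ℝ).bilinearComp D₂ D₂ with hI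
  have hIv : ∀ v, I v v = ‖D₁ v‖ ^ 2 + ‖D₂ v‖ ^ 2 := by
    intro v
    simp only [hI, add_apply, ContinuousLinearMap.bilinearComp_apply, innerSL_apply_apply,
      real_inner_self_eq_norm_sq]
  have hIge : ∀ v, ‖v‖ ^ 2 ≤ I v v := by
    intro v
    rw [hIv]
    have h := hnmax v
    have h0 := norm_nonneg v
    rcases le_max_iff.1 h with h | h <;> nlinarith [sq_nonneg ‖D₁ v‖, sq_nonneg ‖D₂ v‖]
  set B' : V →L[ℝ] V →L[ℝ] ℝ := B + (δ / 2) • I with hB'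
  have hB'v : ∀ v, B' v v = B v v + δ / 2 * I v v := by
    intro v; simp [hB']
  set f : E → ℝ := fun x => W₁ (α x) - N * ‖x - α x‖ ^ 2 with hf
  set g : E → ℝ := fun x => W₂ (β x) - N * ‖x - β x‖ ^ 2 with hg
  set q : V → ℝ := fun v => l (v - c) + 1 / 2 * B' (v - c) (v - c) with hq
  set G : V → ℝ := fun v => (f (D₁ v) + g (D₂ v)) + -(q v) with hG
  have hGlow : LowerParaboloid G ((N + N) + 1 / 2 * ‖B'‖) := by
    refine LowerParaboloid.add (LowerParaboloid.add ?_ ?_) (lowerParaboloid_neg_quadratic c l B')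
    · exact (lowerParaboloid_supConvolution hα).comp_clm hN0.le D₁ hD₁n
    · exact (lowerParaboloid_supConvolution hβ).comp_clm hN0.le D₂ hD₂n
  have hη : 0 < δ / 4 * r ^ 2 / 32 := by positivity
  have hstrict : ∀ v ∈ closedBall c r, r / 4 ≤ ‖v - c‖ → G v + δ / 4 * r ^ 2 / 32 ≤ G c := by
    intro v hv hvr
    have hGc : W₁ c₁ + W₂ c₂ ≤ G c := by
      have h1 := (hα c₁).2 c₁ (mem_closedBall_self hr.le)
      have h2 := (hβ c₂).2 c₂ (mem_closedBall_self hr.le)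
      rw [sub_self, norm_zero] at h1 h2
      simp only [hG, hq, hf, hg, sub_self, map_zero, ← hc₁, ← hc₂]
      linarith
    set x := D₁ v with hx
    set y := D₂ v with hy
    set u : V := J₁ (α x) + J₂ (β y) with hu
    have huK : u ∈ closedBall c r := hmemJ _ (hα x).1 _ (hβ y).1
    have hm := hmax u huK
    rw [hu, hDJ₁, hDJ₂, ← hu] at hm
    have hub : ‖u - c‖ ≤ r := by rw [← dist_eq_norm]; exact huK
    have hvb : ‖v - c‖ ≤ r := by rw [← dist_eq_norm]; exact hv
    set t : ℝ := ‖u - v‖ with ht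
    have ht0 : 0 ≤ t := norm_nonneg _
    have hlip : l (u - c) + 1 / 2 * B (u - c) (u - c)
        - (l (v - c) + 1 / 2 * B (v - c) (v - c)) ≤ Lq * t := by
      have := quadratic_sub_le (l := l) (B := B) hub hvb
      rwa [sub_sub_sub_cancel_right] at this
    have hpen : N * t ^ 2 ≤ N * ‖x - α x‖ ^ 2 + N * ‖y - β y‖ ^ 2 := by
      have h := hIge (u - v)
      rw [hIv] at h
      have h1 : ‖D₁ (u - v)‖ = ‖x - α x‖ := by rw [map_sub, hu, hDJ₁]; exact norm_sub_rev _ _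
      have h2 : ‖D₂ (u - v)‖ = ‖y - β y‖ := by rw [map_sub, hu, hDJ₂]; exact norm_sub_rev _ _
      rw [h1, h2] at h
      rw [← mul_add]
      gcongr
    have hquad : Lq * t - N * t ^ 2 ≤ δ / 4 * r ^ 2 / 32 := by
      have h0 : 0 ≤ (2 * N * t - Lq) ^ 2 := sq_nonneg _
      have : N * (4 * (Lq * t - N * t ^ 2)) ≤ N * (4 * (δ / 4 * r ^ 2 / 32)) := by
        nlinarith
      have := le_of_mul_le_mul_left this hN0
      linarith
    have hIr : r ^ 2 / 16 ≤ I (v - c) (v - c) := by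
      refine le_trans ?_ (hIge _)
      have : (r / 4) ^ 2 ≤ ‖v - c‖ ^ 2 := by gcongr
      linarith
    have hGv : G v = (W₁ (α x) - N * ‖x - α x‖ ^ 2) + (W₂ (β y) - N * ‖y - β y‖ ^ 2)
        - (l (v - c) + 1 / 2 * (B (v - c) (v - c) + δ / 2 * I (v - c) (v - c))) := by
      simp only [hG, hq, hf, hg, hB'v, ← hx, ← hy]
      ring
    rw [hGv]
    nlinarith
  have hGmax : ∀ p : V →L[ℝ] ℝ, ∃ x ∈ closedBall c r, ∀ y ∈ closedBall c r,
      G y - p y ≤ G x - p x := by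
    intro p
    have hcont : ContinuousOn (fun z : V × V =>
        (W₁ (D₁ z.1) - N * ‖D₁ z.2 - D₁ z.1‖ ^ 2) + (W₂ (D₂ z.1) - N * ‖D₂ z.2 - D₂ z.1‖ ^ 2) - q z.2 - p z.2)
        (closedBall c r ×ˢ closedBall c r) := by
      have h1 : ContinuousOn (fun z : V × V => W₁ (D₁ z.1))
          (closedBall c r ×ˢ closedBall c r) := by
        refine hW₁.comp (Continuous.continuousOn (by fun_prop)) ?_
        rintro z ⟨hz, _⟩
        exact (hmemD _ hz).1
      have h2 : ContinuousOn (fun z : V × V => W₂ (D₂ z.1))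
          (closedBall c r ×ˢ closedBall c r) := by
        refine hW₂.comp (Continuous.continuousOn (by fun_prop)) ?_
        rintro z ⟨hz, _⟩
        exact (hmemD _ hz).2
      have h3 : Continuous q := by simp only [hq]; fun_prop
      have h4 : Continuous fun z : V × V => N * ‖D₁ z.2 - D₁ z.1‖ ^ 2 := by fun_prop
      have h5 : Continuous fun z : V × V => N * ‖D₂ z.2 - D₂ z.1‖ ^ 2 := by fun_prop
      exact (((h1.sub h4.continuousOn).add (h2.sub h5.continuousOn)).sub
        (h3.comp continuous_snd).continuousOn).sub (p.continuous.comp continuous_snd).continuousOn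
    obtain ⟨⟨ab, x⟩, ⟨hab, hx⟩, hz⟩ :=
      ((isCompact_closedBall c r).prod (isCompact_closedBall c r)).exists_isMaxOn
        ⟨(c, c), mem_closedBall_self hr.le, mem_closedBall_self hr.le⟩ hcont
    refine ⟨x, hx, fun y hy => ?_⟩
    have hmem : (J₁ (α (D₁ y)) + J₂ (β (D₂ y)), y) ∈ closedBall c r ×ˢ closedBall c r :=
      ⟨hmemJ _ (hα _).1 _ (hβ _).1, hy⟩
    have h1 := hz hmem
    simp only [Set.mem_ofPred_eq, hDJ₁, hDJ₂] at h1
    have h2 := (hα (D₁ x)).2 _ (hmemD _ hab).1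
    have h3 := (hβ (D₂ x)).2 _ (hmemD _ hab).2
    simp only [hG, hf, hg]
    linarith
  obtain ⟨v₀, hv₀, p, H, htouch, hexp⟩ :=
    hGlow.exists_touching_second_order (by positivity) hr hη hstrict hGmax
  set x := D₁ v₀ with hx
  set y := D₂ v₀ with hy
  have hxyb : x ∈ ball c₁ (r / 4) ∧ y ∈ ball c₂ (r / 4) := by
    rw [mem_ball, dist_eq_norm] at hv₀
    rw [mem_ball, dist_eq_norm, mem_ball, dist_eq_norm, hx, hy, hc₁, hc₂, ← map_sub, ← map_sub]
    exact ⟨(hD₁n _).trans_lt hv₀, (hD₂n _).trans_lt hv₀⟩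
  have haα := dist_supConvolution_argmax_lt hr hα hM₁ hNM1 hxyb.1
  have hbβ := dist_supConvolution_argmax_lt hr hβ hM₂ hNM2 hxyb.2
  set T : V →L[ℝ] ℝ := p + (l + (1 / 2 : ℝ) • (B' (v₀ - c) + B'.flip (v₀ - c))) with hT
  set Q : V →L[ℝ] V →L[ℝ] ℝ := H + B' with hQ
  have hqexp : ∀ v, q (v₀ + v) = q v₀ + (T v - p v) + 1 / 2 * B' v v := by
    intro v
    have e : v₀ + v - c = (v₀ - c) + v := by abel
    simp only [hq, hT, e, map_add, add_apply, smul_apply, smul_eq_mul,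
      ContinuousLinearMap.flip_apply]
    ring
  have hsum : ∀ ε > 0, ∀ᶠ v in 𝓝 (0 : V),
      |(f (x + D₁ v) + g (y + D₂ v)) - (f x + g y) - T v - 1 / 2 * Q v v| ≤ ε * ‖v‖ ^ 2 := by
    intro ε hε
    filter_upwards [hexp ε hε] with v hv
    have e : (f (x + D₁ v) + g (y + D₂ v)) - (f x + g y) - T v - 1 / 2 * Q v v
        = G (v₀ + v) - G v₀ - p v - 1 / 2 * H v v := by
      have h1 := hqexp v
      simp only [hG, hQ, add_apply, h1, map_add, ← hx, ← hy]
      ring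
    rw [e]; exact hv
  have hε : 0 < δ / 8 := by positivity
  have hf2 : ∀ᶠ h in 𝓝 (0 : E),
      |f (x + h) - f x - T (J₁ h) - 1 / 2 * Q (J₁ h) (J₁ h)| ≤ δ / 8 * ‖h‖ ^ 2 := by
    have ht : Tendsto J₁ (𝓝 0) (𝓝 0) := by simpa using J₁.continuous.tendsto 0
    filter_upwards [ht.eventually (hsum _ hε)] with h hh
    have hn := hJn₁ h
    rw [hDJ₁₁, hDJ₂₁, add_zero] at hh
    have : δ / 8 * ‖J₁ h‖ ^ 2 ≤ δ / 8 * ‖h‖ ^ 2 := by gcongr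
    refine le_trans (le_of_eq_of_le ?_ hh) this
    congr 1
    ring
  have hg2 : ∀ᶠ k in 𝓝 (0 : E),
      |g (y + k) - g y - T (J₂ k) - 1 / 2 * Q (J₂ k) (J₂ k)| ≤ δ / 8 * ‖k‖ ^ 2 := by
    have ht : Tendsto J₂ (𝓝 0) (𝓝 0) := by simpa using J₂.continuous.tendsto 0
    filter_upwards [ht.eventually (hsum _ hε)] with h hh
    have hn := hJn₂ h
    rw [hDJ₁₂, hDJ₂₂, add_zero] at hh
    have : δ / 8 * ‖J₂ h‖ ^ 2 ≤ δ / 8 * ‖h‖ ^ 2 := by gcongr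
    refine le_trans (le_of_eq_of_le ?_ hh) this
    congr 1
    ring
  obtain ⟨S, hS⟩ : ∃ S : E →L[ℝ] E →L[ℝ] ℝ, ∀ h, S h h = ‖h‖ ^ 2 :=
    ⟨innerSL ℝ, fun h => by rw [innerSL_apply_apply, real_inner_self_eq_norm_sq]⟩
  refine ⟨α x, haα, β y, hbβ, T.comp J₁, T.comp J₂,
    Q.bilinearComp J₁ J₁ + (δ / 4) • S, Q.bilinearComp J₂ J₂ + (δ / 4) • S,
    ?_, ?_, ?_⟩
  · refine supConvolution_touching hα (closedBall_mem_nhds_of_mem haα) ?_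
    filter_upwards [hf2] with h hh
    have := (abs_le.1 hh).2
    simp only [add_apply, smul_apply, ContinuousLinearMap.bilinearComp_apply, smul_eq_mul,
      ContinuousLinearMap.comp_apply]
    rw [hS]
    linarith
  · refine supConvolution_touching hβ (closedBall_mem_nhds_of_mem hbβ) ?_
    filter_upwards [hg2] with h hh
    have := (abs_le.1 hh).2
    simp only [add_apply, smul_apply, ContinuousLinearMap.bilinearComp_apply, smul_eq_mul,
      ContinuousLinearMap.comp_apply]
    rw [hS]
    linarith
  · intro h k
    simp only [add_apply, smul_apply, ContinuousLinearMap.bilinearComp_apply, smul_eq_mul]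
    rw [hS, hS]
    have t1 : Tendsto (fun t : ℝ => t • h) (𝓝[>] 0) (𝓝 0) := by
      have : Tendsto (fun t : ℝ => t • h) (𝓝 0) (𝓝 ((0 : ℝ) • h)) :=
        Continuous.tendsto (by fun_prop) 0
      rw [zero_smul] at this
      exact this.mono_left nhdsWithin_le_nhds
    have t2 : Tendsto (fun t : ℝ => t • k) (𝓝[>] 0) (𝓝 0) := by
      have : Tendsto (fun t : ℝ => t • k) (𝓝 0) (𝓝 ((0 : ℝ) • k)) :=
        Continuous.tendsto (by fun_prop) 0
      rw [zero_smul] at this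
      exact this.mono_left nhdsWithin_le_nhds
    set w : V := J₁ h + J₂ k with hw
    have hw₁ : D₁ w = h := hDJ₁ h k
    have hw₂ : D₂ w = k := hDJ₂ h k
    have t3 : Tendsto (fun t : ℝ => v₀ + t • w) (𝓝[>] 0) (𝓝 v₀) := by
      have : Tendsto (fun t : ℝ => v₀ + t • w) (𝓝 0)
          (𝓝 (v₀ + (0 : ℝ) • w)) := Continuous.tendsto (by fun_prop) 0
      rw [zero_smul, add_zero] at this
      exact this.mono_left nhdsWithin_le_nhds
    have hv₀K : closedBall c r ∈ 𝓝 v₀ :=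
      closedBall_mem_nhds_of_mem (ball_subset_ball (by linarith) hv₀)
    obtain ⟨t, ⟨⟨hft, hgt⟩, hKt⟩, ht0⟩ := (((t1.eventually hf2).and (t2.eventually hg2)).and
      (t3.eventually hv₀K)).and self_mem_nhdsWithin |>.exists
    have ht0 : 0 < t := ht0
    have hm := htouch _ hKt
    rw [add_sub_cancel_left] at hm
    have hqe := hqexp (t • w)
    have hGe : G (v₀ + t • w) = f (x + t • h) + g (y + t • k)
        - q (v₀ + t • w) := by
      simp only [hG, map_add, map_smul, hw₁, hw₂, ← hx, ← hy]
      ring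
    have hG0 : G v₀ = f x + g y - q v₀ := by
      simp only [hG, ← hx, ← hy]
      ring
    have hT2 : T w = T (J₁ h) + T (J₂ k) := map_add _ _ _
    rw [norm_smul, Real.norm_of_nonneg ht0.le] at hft hgt
    simp only [map_smul, smul_apply, smul_eq_mul] at hft hgt hqe hm
    have h1 := (abs_le.1 hft).1
    have h2 := (abs_le.1 hgt).1
    rw [hGe, hG0, hqe] at hm
    rw [hT2] at hm
    have hB'' := hB'v w
    rw [hIv, hw₁, hw₂] at hB''
    have key : t ^ 2 * (Q (J₁ h) (J₁ h) + Q (J₂ k) (J₂ k))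
        ≤ t ^ 2 * (B' w w + δ / 4 * (‖h‖ ^ 2 + ‖k‖ ^ 2)) := by
      nlinarith
    have key2 := le_of_mul_le_mul_left key (by positivity)
    rw [hB''] at key2
    linarith

lemma exists_touching_of_split_penalised_max [FiniteDimensional ℝ E] [FiniteDimensional ℝ V]
    {D₁ D₂ : V →L[ℝ] E} {J₁ J₂ : E →L[ℝ] V} (hD₁n : ∀ v, ‖D₁ v‖ ≤ ‖v‖)
    (hD₂n : ∀ v, ‖D₂ v‖ ≤ ‖v‖) (hnmax : ∀ v, ‖v‖ ≤ max ‖D₁ v‖ ‖D₂ v‖)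
    (hDJ₁ : ∀ h k, D₁ (J₁ h + J₂ k) = h) (hDJ₂ : ∀ h k, D₂ (J₁ h + J₂ k) = k)
    {W₁ W₂ : E → ℝ} {c₁ c₂ : E}
    {r : ℝ} (hr : 0 < r) (hW₁ : ContinuousOn W₁ (closedBall c₁ r))
    (hW₂ : ContinuousOn W₂ (closedBall c₂ r)) {l₁ l₂ : E →L[ℝ] ℝ} {A β κ : ℝ} {e : E}
    (hmax : ∀ x ∈ closedBall c₁ r, ∀ y ∈ closedBall c₂ r, W₁ x + W₂ y ≤ W₁ c₁ + W₂ c₂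
      + l₁ (x - c₁) + l₂ (y - c₂) + A * ‖(x - c₁) - (y - c₂)‖ ^ 2
      - β * ⟪e, (x - c₁) - (y - c₂)⟫ ^ 2 + κ * ‖x - c₁‖ ^ 2)
    {δ : ℝ} (hδ : 0 < δ) :
    ∃ a ∈ ball c₁ r, ∃ b ∈ ball c₂ r, ∃ (p q : E →L[ℝ] ℝ) (X Y : E →L[ℝ] E →L[ℝ] ℝ),
      (∀ᶠ h in 𝓝 (0 : E), W₁ (a + h) ≤ W₁ a + (p h + 1 / 2 * X h h)) ∧
      (∀ᶠ h in 𝓝 (0 : E), W₂ (b + h) ≤ W₂ b + (q h + 1 / 2 * Y h h)) ∧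
      ∀ h k, X h h + Y k k ≤ 2 * A * ‖h - k‖ ^ 2 - 2 * β * ⟪e, h - k⟫ ^ 2 + 2 * κ * ‖h‖ ^ 2
        + δ * (‖h‖ ^ 2 + ‖k‖ ^ 2) := by
  obtain ⟨S, hS⟩ : ∃ S : E →L[ℝ] E →L[ℝ] ℝ, ∀ h, S h h = ‖h‖ ^ 2 :=
    ⟨innerSL ℝ, fun h => by rw [innerSL_apply_apply, real_inner_self_eq_norm_sq]⟩
  obtain ⟨R, hR⟩ : ∃ R : E →L[ℝ] E →L[ℝ] ℝ, ∀ h, R h h = ⟪e, h⟫ ^ 2 :=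
    ⟨(ContinuousLinearMap.mul ℝ ℝ).bilinearComp (innerSL ℝ e) (innerSL ℝ e), fun h => by
      rw [ContinuousLinearMap.bilinearComp_apply, innerSL_apply_apply,
        ContinuousLinearMap.mul_apply', sq]⟩
  set Q : E →L[ℝ] E →L[ℝ] ℝ := (2 * A) • S - (2 * β) • R with hQ
  set B : V →L[ℝ] V →L[ℝ] ℝ :=
    Q.bilinearComp (D₁ - D₂) (D₁ - D₂) + ((2 * κ) • S).bilinearComp D₁ D₁ with hB
  have hBv : ∀ v, B v v = 2 * A * ‖D₁ v - D₂ v‖ ^ 2 - 2 * β * ⟪e, D₁ v - D₂ v⟫ ^ 2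
      + 2 * κ * ‖D₁ v‖ ^ 2 := by
    intro v
    simp only [hB, hQ, add_apply, ContinuousLinearMap.bilinearComp_apply, sub_apply, smul_apply,
      smul_eq_mul, hS, hR]
  set c : V := J₁ c₁ + J₂ c₂ with hc
  have hc₁ : D₁ c = c₁ := hDJ₁ _ _
  have hc₂ : D₂ c = c₂ := hDJ₂ _ _
  have h := exists_quadratic_touching_of_split_sum_max hD₁n hD₂n hnmax hDJ₁ hDJ₂ (W₁ := W₁)
    (W₂ := W₂) (c := c) hr (by rwa [hc₁]) (by rwa [hc₂]) (l := l₁.comp D₁ + l₂.comp D₂) (B := B)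
    (fun v hv => by
      rw [mem_closedBall, dist_eq_norm] at hv
      have h := hmax (D₁ v) (by
        rw [mem_closedBall, dist_eq_norm, ← hc₁, ← map_sub]; exact (hD₁n _).trans hv) (D₂ v) (by
        rw [mem_closedBall, dist_eq_norm, ← hc₂, ← map_sub]; exact (hD₂n _).trans hv)
      rw [hBv, add_apply, ContinuousLinearMap.comp_apply, ContinuousLinearMap.comp_apply, map_sub D₁,
        map_sub D₂, hc₁, hc₂]
      linarith) hδ
  rw [hc₁, hc₂] at h
  obtain ⟨a, ha, b, hb, p, q, X, Y, h1, h2, h3⟩ := h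
  refine ⟨a, ha, b, hb, p, q, X, Y, h1, h2, fun h k => ?_⟩
  have h4 := h3 h k
  rwa [hBv, hDJ₁, hDJ₂] at h4

lemma exists_touching_of_penalised_max [FiniteDimensional ℝ E]
    {W₁ W₂ : E → ℝ} {c₁ c₂ : E}
    {r : ℝ} (hr : 0 < r) (hW₁ : ContinuousOn W₁ (closedBall c₁ r))
    (hW₂ : ContinuousOn W₂ (closedBall c₂ r)) {l₁ l₂ : E →L[ℝ] ℝ} {A β κ : ℝ} {e : E}
    (hmax : ∀ x ∈ closedBall c₁ r, ∀ y ∈ closedBall c₂ r, W₁ x + W₂ y ≤ W₁ c₁ + W₂ c₂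
      + l₁ (x - c₁) + l₂ (y - c₂) + A * ‖(x - c₁) - (y - c₂)‖ ^ 2
      - β * ⟪e, (x - c₁) - (y - c₂)⟫ ^ 2 + κ * ‖x - c₁‖ ^ 2)
    {δ : ℝ} (hδ : 0 < δ) :
    ∃ a ∈ ball c₁ r, ∃ b ∈ ball c₂ r, ∃ (p q : E →L[ℝ] ℝ) (X Y : E →L[ℝ] E →L[ℝ] ℝ),
      (∀ᶠ h in 𝓝 (0 : E), W₁ (a + h) ≤ W₁ a + (p h + 1 / 2 * X h h)) ∧
      (∀ᶠ h in 𝓝 (0 : E), W₂ (b + h) ≤ W₂ b + (q h + 1 / 2 * Y h h)) ∧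
      ∀ h k, X h h + Y k k ≤ 2 * A * ‖h - k‖ ^ 2 - 2 * β * ⟪e, h - k⟫ ^ 2 + 2 * κ * ‖h‖ ^ 2
        + δ * (‖h‖ ^ 2 + ‖k‖ ^ 2) :=
  exists_touching_of_split_penalised_max (D₁ := ContinuousLinearMap.fst ℝ E E)
    (D₂ := ContinuousLinearMap.snd ℝ E E) (J₁ := ContinuousLinearMap.inl ℝ E E)
    (J₂ := ContinuousLinearMap.inr ℝ E E) (fun v => norm_fst_le v) (fun v => norm_snd_le v)
    (fun v => le_of_eq (Prod.norm_def v)) (fun h k => by simp) (fun h k => by simp) hr hW₁ hW₂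
    hmax hδ

end SupConvolution

section QuadraticTests

open Filter Topology

variable {n : ℕ}

/-- The symmetric matrix of the quadratic form `h ↦ b h h`. -/
def formMatrix (b : Euc n →L[ℝ] Euc n →L[ℝ] ℝ) : Matrix (Fin n) (Fin n) ℝ :=
  fun i j => 1 / 2 * (b (EuclideanSpace.single i 1) (EuclideanSpace.single j 1)
    + b (EuclideanSpace.single j 1) (EuclideanSpace.single i 1))

lemma formMatrix_isSymm (b : Euc n →L[ℝ] Euc n →L[ℝ] ℝ) : (formMatrix b).IsSymm := by
  ext i j
  simp only [formMatrix, Matrix.transpose_apply]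
  ring

lemma formMatrix_add (b c : Euc n →L[ℝ] Euc n →L[ℝ] ℝ) :
    formMatrix (b + c) = formMatrix b + formMatrix c := by
  ext i j
  simp only [formMatrix, Matrix.add_apply, add_apply]
  ring

lemma inner_formMatrix (b : Euc n →L[ℝ] Euc n →L[ℝ] ℝ) (h : Euc n) :
    ⟪h, Matrix.toEuclideanCLM (𝕜 := ℝ) (formMatrix b) h⟫ = b h h := by
  have hh : h = ∑ i, h i • EuclideanSpace.single i (1 : ℝ) := by
    ext j
    simp [Finset.sum_apply, Pi.single_apply]
  have e : b h h = ∑ i, ∑ j, h i * (h j *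
      b (EuclideanSpace.single i 1) (EuclideanSpace.single j 1)) := by
    conv_lhs => rw [hh]
    simp only [map_sum, map_smul, sum_apply, smul_apply, smul_eq_mul,
      Finset.mul_sum]
    rw [Finset.sum_comm]
    refine Finset.sum_congr rfl fun i _ => Finset.sum_congr rfl fun j _ => ?_
    ring
  have e2 : b h h = ∑ i, ∑ j, h i * (h j *
      b (EuclideanSpace.single j 1) (EuclideanSpace.single i 1)) := by
    rw [e, Finset.sum_comm]
    refine Finset.sum_congr rfl fun i _ => Finset.sum_congr rfl fun j _ => ?_
    ring
  have e3 : ⟪h, Matrix.toEuclideanCLM (𝕜 := ℝ) (formMatrix b) h⟫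
      = 1 / 2 * (b h h + b h h) := by
    conv_rhs => rw [e2]
    conv_rhs => enter [2, 1]; rw [← e2, e]
    rw [← Finset.sum_add_distrib, Finset.mul_sum]
    simp only [PiLp.inner_apply, Matrix.ofLp_toEuclideanCLM, Matrix.mulVec, dotProduct,
      formMatrix]
    refine Finset.sum_congr rfl fun i _ => ?_
    simp only [RCLike.inner_apply, conj_trivial]
    rw [← Finset.sum_add_distrib, Finset.mul_sum, Finset.sum_mul]
    refine Finset.sum_congr rfl fun j _ => ?_
    ring
  rw [e3]; ring

lemma formMatrix_posSemidef {b : Euc n →L[ℝ] Euc n →L[ℝ] ℝ} (hb : ∀ h, 0 ≤ b h h) :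
    (formMatrix b).PosSemidef := by
  refine Matrix.PosSemidef.of_dotProduct_mulVec_nonneg ?_ fun x => ?_
  · have := formMatrix_isSymm b
    rwa [Matrix.IsHermitian, Matrix.conjTranspose_eq_transpose_of_trivial]
  · have h := hb (WithLp.toLp 2 x)
    rw [← inner_formMatrix] at h
    simpa [PiLp.inner_apply, dotProduct, mul_comm] using h

lemma form_le_opNorm (b : Euc n →L[ℝ] Euc n →L[ℝ] ℝ) {e : Euc n} (he : ‖e‖ = 1) :
    b e e ≤ opNorm (formMatrix b) := by
  rw [← inner_formMatrix]
  refine (real_inner_le_norm _ _).trans ?_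
  rw [he, one_mul]
  refine (ContinuousLinearMap.le_opNorm _ _).trans ?_
  rw [he, mul_one, opNorm]

lemma opNorm_formMatrix_le {C : ℝ} (hC : 0 ≤ C) {b : Euc n →L[ℝ] Euc n →L[ℝ] ℝ}
    (hb : ∀ h k, b h k = C * ⟪h, k⟫) : opNorm (formMatrix b) ≤ C := by
  have : formMatrix b = C • (1 : Matrix (Fin n) (Fin n) ℝ) := by
    ext i j
    simp [formMatrix, hb, Matrix.one_apply, EuclideanSpace.inner_single_left]
    split_ifs <;> simp_all <;> ring
  rw [opNorm, this, map_smul, map_one]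
  refine ContinuousLinearMap.opNorm_le_bound _ hC fun x => ?_
  simp [norm_smul, abs_of_nonneg hC]

lemma UniformlyElliptic.le_of_form_le {F : Matrix (Fin n) (Fin n) ℝ → ℝ} {lb ub : ℝ}
    (hF : UniformlyElliptic F lb ub) (hlb : 0 ≤ lb) (hub : 0 ≤ ub)
    {X Y : Euc n →L[ℝ] Euc n →L[ℝ] ℝ} {C m : ℝ} (hC : 0 ≤ C)
    (hXY : ∀ h, X h h ≤ Y h h + C * ‖h‖ ^ 2) {e : Euc n} (he : ‖e‖ = 1)
    (hXYe : X e e ≤ Y e e + C - m) :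
    F (formMatrix X) ≤ F (formMatrix Y) + ub * C - lb * m := by
  obtain ⟨S, hS⟩ : ∃ S : Euc n →L[ℝ] Euc n →L[ℝ] ℝ, ∀ h k, S h k = C * ⟪h, k⟫ :=
    ⟨C • innerSL ℝ, fun h k => by
      rw [smul_apply, smul_apply, innerSL_apply_apply, smul_eq_mul]⟩
  have hSS : ∀ h, S h h = C * ‖h‖ ^ 2 := fun h => by rw [hS, real_inner_self_eq_norm_sq]
  have h1 := (hF (formMatrix Y) (formMatrix S) (formMatrix_isSymm Y)
    (formMatrix_posSemidef fun h => by rw [hSS]; positivity)).2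
  have h2 : ub * opNorm (formMatrix S) ≤ ub * C := by
    gcongr; exact opNorm_formMatrix_le hC hS
  set P : Euc n →L[ℝ] Euc n →L[ℝ] ℝ := Y + S - X with hP
  have hPh : ∀ h, P h h = Y h h + C * ‖h‖ ^ 2 - X h h := fun h => by
    simp only [hP, sub_apply, add_apply, hSS]
  have h3 := (hF (formMatrix X) (formMatrix P) (formMatrix_isSymm X)
    (formMatrix_posSemidef fun h => by rw [hPh]; linarith [hXY h])).1
  have h4 : lb * m ≤ lb * opNorm (formMatrix P) := by
    gcongr
    refine le_trans ?_ (form_le_opNorm P he)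
    rw [hPh, he]; linarith
  have h5 : formMatrix X + formMatrix P = formMatrix Y + formMatrix S := by
    rw [← formMatrix_add, ← formMatrix_add, hP]
    congr 1; abel
  rw [h5] at h3
  linarith

lemma contDiff_quadratic {V : Type*} [NormedAddCommGroup V] [NormedSpace ℝ V] (a : V) (c : ℝ)
    (l : V →L[ℝ] ℝ) (b : V →L[ℝ] V →L[ℝ] ℝ) {k : WithTop ℕ∞} :
    ContDiff ℝ k fun x => c + l (x - a) + 1 / 2 * b (x - a) (x - a) := by
  have h1 : ContDiff ℝ k fun x : V => x - a := by fun_prop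
  have h2 : ContDiff ℝ k fun x : V => b (x - a) := b.contDiff.comp h1
  have h3 : ContDiff ℝ k fun x : V => b (x - a) (x - a) := h2.clm_apply h1
  have h4 : ContDiff ℝ k fun x : V => l (x - a) := l.contDiff.comp h1
  exact (contDiff_const.add h4).add (contDiff_const.mul h3)

lemma hess2_quadratic (a : Euc n) (c : ℝ) (l : Euc n →L[ℝ] ℝ) (b : Euc n →L[ℝ] Euc n →L[ℝ] ℝ) :
    hess2 (fun x => c + l (x - a) + 1 / 2 * b (x - a) (x - a)) a = formMatrix b := by
  have hd : ∀ x, HasFDerivAt (fun x => c + l (x - a) + 1 / 2 * b (x - a) (x - a))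
      (l + (1 / 2 : ℝ) • ((b + b.flip) (x - a))) x := by
    intro x
    have h1 : HasFDerivAt (fun x : Euc n => x - a) (ContinuousLinearMap.id ℝ _) x :=
      (hasFDerivAt_id x).sub_const a
    have h2 : HasFDerivAt (fun x : Euc n => l (x - a)) (l.comp (ContinuousLinearMap.id ℝ _)) x :=
      l.hasFDerivAt.comp x h1
    have h3 : HasFDerivAt (fun x : Euc n => b (x - a)) (b.comp (ContinuousLinearMap.id ℝ _)) x :=
      b.hasFDerivAt.comp x h1
    have h4 := h3.clm_apply h1
    have h5 := (h2.const_add c).add (h4.const_mul (1 / 2))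
    refine h5.congr_fderiv ?_
    ext v
    simp
  have hd' : fderiv ℝ (fun x => c + l (x - a) + 1 / 2 * b (x - a) (x - a))
      = fun x => l + (1 / 2 : ℝ) • ((b + b.flip) (x - a)) := funext fun x => (hd x).fderiv
  ext i j
  rw [hess2, iteratedFDeriv_two_apply, hd']
  have h1 : HasFDerivAt (fun x : Euc n => x - a) (ContinuousLinearMap.id ℝ _) a :=
    (hasFDerivAt_id a).sub_const a
  have h2 : HasFDerivAt (fun x : Euc n => l + (1 / 2 : ℝ) • ((b + b.flip) (x - a)))
      ((1 / 2 : ℝ) • (b + b.flip).comp (ContinuousLinearMap.id ℝ _)) a :=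
    (((b + b.flip).hasFDerivAt.comp a h1).const_smul (1 / 2 : ℝ)).const_add l
  rw [h2.fderiv]
  simp only [smul_apply, ContinuousLinearMap.comp_apply, ContinuousLinearMap.id_apply, add_apply,
    ContinuousLinearMap.flip_apply, smul_eq_mul, formMatrix, Matrix.cons_val_zero,
    Matrix.cons_val_one]

lemma ViscSubsol.nonneg_of_quadratic {F : Matrix (Fin n) (Fin n) ℝ → ℝ} {U : Set (Euc n)}
    {u : Euc n → ℝ} (hu : ViscSubsol F U u) {a : Euc n} (ha : a ∈ U) {l : Euc n →L[ℝ] ℝ}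
    {b : Euc n →L[ℝ] Euc n →L[ℝ] ℝ}
    (h : ∀ᶠ h in 𝓝 (0 : Euc n), u (a + h) ≤ u a + (l h + 1 / 2 * b h h)) :
    0 ≤ F (formMatrix b) := by
  rw [← hess2_quadratic a (u a) l b]
  refine hu a ha _ (contDiff_quadratic a _ l b) (by simp) ?_
  have ht : Tendsto (fun x : Euc n => x - a) (𝓝 a) (𝓝 0) := by
    have : Tendsto (fun x : Euc n => x - a) (𝓝 a) (𝓝 (a - a)) := Continuous.tendsto (by fun_prop) a
    rwa [sub_self] at this
  filter_upwards [ht.eventually h] with x hx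
  rw [add_sub_cancel] at hx
  linarith

lemma ViscSupersol.nonpos_of_quadratic {F : Matrix (Fin n) (Fin n) ℝ → ℝ} {U : Set (Euc n)}
    {u : Euc n → ℝ} (hu : ViscSupersol F U u) {a : Euc n} (ha : a ∈ U) {l : Euc n →L[ℝ] ℝ}
    {b : Euc n →L[ℝ] Euc n →L[ℝ] ℝ}
    (h : ∀ᶠ h in 𝓝 (0 : Euc n), u a + (l h + 1 / 2 * b h h) ≤ u (a + h)) :
    F (formMatrix b) ≤ 0 := by
  rw [← hess2_quadratic a (u a) l b]
  refine hu a ha _ (contDiff_quadratic a _ l b) (by simp) ?_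
  have ht : Tendsto (fun x : Euc n => x - a) (𝓝 a) (𝓝 0) := by
    have : Tendsto (fun x : Euc n => x - a) (𝓝 a) (𝓝 (a - a)) := Continuous.tendsto (by fun_prop) a
    rwa [sub_self] at this
  filter_upwards [ht.eventually h] with x hx
  rw [add_sub_cancel] at hx
  linarith

end QuadraticTests

section InteriorLipschitz

open Filter Topology

lemma norm_smul_add_le_of_unit {E : Type*} [NormedAddCommGroup E] [InnerProductSpace ℝ E]
    {e η : E} {t : ℝ} (ht : 0 < t) (he : ‖e‖ = 1) (hη : ‖η‖ ≤ t / 2) :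
    ‖t • e + η‖ ≤ t + ⟪e, η⟫ + (‖η‖ ^ 2 - ⟪e, η⟫ ^ 2) / t := by
  have hs : |⟪e, η⟫| ≤ ‖η‖ := by
    have := abs_real_inner_le_norm e η
    rwa [he, one_mul] at this
  have hs2 := abs_le.1 hs
  set s : ℝ := ⟪e, η⟫ with hs'
  have hp : 0 ≤ ‖η‖ ^ 2 - s ^ 2 := by nlinarith [norm_nonneg η, hs2.1, hs2.2]
  have hsq : ‖t • e + η‖ ^ 2 = (t + s) ^ 2 + (‖η‖ ^ 2 - s ^ 2) := by
    rw [norm_add_sq_real, norm_smul, he, Real.norm_of_nonneg ht.le, real_inner_smul_left]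
    ring
  have hts : t / 2 ≤ t + s := by linarith [hs2.1]
  set P : ℝ := (‖η‖ ^ 2 - s ^ 2) / t with hP
  have hPt : ‖η‖ ^ 2 - s ^ 2 = P * t := by rw [hP]; field_simp
  have hP0 : 0 ≤ P := by positivity
  refine abs_le_of_sq_le_sq' ?_ (by linarith) |>.2
  rw [hsq, hPt]
  nlinarith

variable {n : ℕ}

/-- Interior Lipschitz estimate of Ishii–Lions type for bounded solutions of a uniformly elliptic
equation. -/
lemma UniformlyElliptic.sub_le_of_solution {F : Matrix (Fin n) (Fin n) ℝ → ℝ} {lb ub : ℝ}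
    (hF : UniformlyElliptic F lb ub) (hlb : 0 < lb) (hle : lb ≤ ub)
    {w : Euc n → ℝ} {c : Euc n} {R S : ℝ} (hR : 0 < R) (hS : 0 < S)
    (hw : ContinuousOn w (closedBall c R)) (hw0 : ∀ x ∈ closedBall c R, 0 ≤ w x)
    (hwS : ∀ x ∈ closedBall c R, w x ≤ S)
    (hsub : ∀ a ∈ closedBall c R, ∀ (l : Euc n →L[ℝ] ℝ) (b : Euc n →L[ℝ] Euc n →L[ℝ] ℝ),
      (∀ᶠ h in 𝓝 (0 : Euc n), w (a + h) ≤ w a + (l h + 1 / 2 * b h h)) → 0 ≤ F (formMatrix b))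
    (hsup : ∀ a ∈ closedBall c R, ∀ (l : Euc n →L[ℝ] ℝ) (b : Euc n →L[ℝ] Euc n →L[ℝ] ℝ),
      (∀ᶠ h in 𝓝 (0 : Euc n), w a + (l h + 1 / 2 * b h h) ≤ w (a + h)) → F (formMatrix b) ≤ 0)
    {z : Euc n} (hz : ‖z - c‖ ≤ R / 4) :
    w c - w z ≤ 9 * (ub / lb) * S / R * ‖z - c‖ := by
  by_contra! hcon
  have hub : 0 < ub := hlb.trans_le hle
  have hq : 1 ≤ ub / lb := by rwa [one_le_div hlb]
  obtain ⟨L, hL⟩ : ∃ L, L = 9 * (ub / lb) * S / R := ⟨_, rfl⟩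
  obtain ⟨κ, hκ⟩ : ∃ κ, κ = 5 * S / R ^ 2 := ⟨_, rfl⟩
  have hL0 : 0 < L := by rw [hL]; positivity
  have hκ0 : 0 < κ := by rw [hκ]; positivity
  have hLR : S < L * (R / 8) := by
    have : L * (R / 8) = 9 / 8 * (ub / lb) * S := by rw [hL]; field_simp
    rw [this]; nlinarith
  have hκR : κ * (R / 2) ^ 2 = 5 / 4 * S := by rw [hκ]; field_simp; norm_num
  rw [← hL] at hcon
  set ψ : ℝ → ℝ := fun t => t - 2 / R * t ^ 2 with hψ
  have hψ0 : ∀ t, 0 ≤ t → t ≤ R / 4 → 0 ≤ ψ t := by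
    intro t h0 h1
    have : 2 / R * t ^ 2 = t * (2 * t / R) := by ring
    have h2 : 2 * t / R ≤ 1 := by rw [div_le_one hR]; linarith
    simp only [hψ]; rw [this]; nlinarith
  have hψle : ∀ t, ψ t ≤ t := by
    intro t
    have : 0 ≤ 2 / R * t ^ 2 := by positivity
    simp only [hψ]; linarith
  have hψR : ψ (R / 4) = R / 8 := by simp only [hψ]; field_simp; norm_num
  set Θ : Euc n × Euc n → ℝ :=
    fun v => w v.1 - w v.2 - L * ψ ‖v.1 - v.2‖ - κ * ‖v.1 - c‖ ^ 2 with hΘ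
  set K : Set (Euc n × Euc n) := {v | ‖v.1 - c‖ ≤ R / 2 ∧ ‖v.1 - v.2‖ ≤ R / 4} with hK
  have hKsub : ∀ v ∈ K, v.1 ∈ closedBall c (3 * R / 4) ∧ v.2 ∈ closedBall c (3 * R / 4) := by
    rintro v ⟨h1, h2⟩
    rw [mem_closedBall, dist_eq_norm, mem_closedBall, dist_eq_norm]
    refine ⟨by linarith, ?_⟩
    have : v.2 - c = (v.1 - c) - (v.1 - v.2) := by abel
    rw [this]
    exact (norm_sub_le _ _).trans (by linarith)
  have hball : closedBall c (3 * R / 4) ⊆ closedBall c R := closedBall_subset_closedBall (by linarith)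
  have hKcl : IsClosed K :=
    (isClosed_le (f := fun v : Euc n × Euc n => ‖v.1 - c‖) (by fun_prop) continuous_const).inter
      (isClosed_le (f := fun v : Euc n × Euc n => ‖v.1 - v.2‖) (by fun_prop) continuous_const)
  have hKc : IsCompact K :=
    ((isCompact_closedBall c (3 * R / 4)).prod (isCompact_closedBall c (3 * R / 4))).of_isClosed_subset
      hKcl fun v hv => hKsub v hv
  have hΘc : ContinuousOn Θ K := by
    have h1 : ContinuousOn (fun v : Euc n × Euc n => w v.1) K :=
      hw.comp continuous_fst.continuousOn fun v hv => hball (hKsub v hv).1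
    have h2 : ContinuousOn (fun v : Euc n × Euc n => w v.2) K :=
      hw.comp continuous_snd.continuousOn fun v hv => hball (hKsub v hv).2
    have h3 : Continuous fun v : Euc n × Euc n => L * ψ ‖v.1 - v.2‖ := by
      simp only [hψ]; fun_prop
    have h4 : Continuous fun v : Euc n × Euc n => κ * ‖v.1 - c‖ ^ 2 := by fun_prop
    exact ((h1.sub h2).sub h3.continuousOn).sub h4.continuousOn
  have hzK : (c, z) ∈ K := by
    refine ⟨?_, ?_⟩
    · simp only [sub_self, norm_zero]; positivity
    · rw [norm_sub_rev]; exact hz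
  obtain ⟨⟨x, y⟩, hxyK, hxymax⟩ := hKc.exists_isMaxOn ⟨_, hzK⟩ hΘc
  have hpos : 0 < Θ (x, y) := by
    have h1 : Θ (c, z) ≤ Θ (x, y) := hxymax hzK
    have h2 : L * ψ ‖c - z‖ ≤ L * ‖c - z‖ := by gcongr; exact hψle _
    have h3 : Θ (c, z) = w c - w z - L * ψ ‖c - z‖ := by
      simp only [hΘ, sub_self, norm_zero]; ring
    rw [norm_sub_rev] at hcon
    linarith
  have hx := (hKsub _ hxyK).1
  have hy := (hKsub _ hxyK).2
  have hxy1 : ‖x - c‖ ≤ R / 2 := hxyK.1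
  have hxy2 : ‖x - y‖ ≤ R / 4 := hxyK.2
  simp only at hx hy
  have hpos' : 0 < w x - w y - L * ψ ‖x - y‖ - κ * ‖x - c‖ ^ 2 := hpos
  have hwxy : w x - w y ≤ S := by
    have := hwS x (hball hx); have := hw0 y (hball hy); linarith
  have hLψ : 0 ≤ L * ψ ‖x - y‖ := mul_nonneg hL0.le (hψ0 _ (norm_nonneg _) hxy2)
  have hκx : 0 ≤ κ * ‖x - c‖ ^ 2 := by positivity
  have hlt1 : ‖x - c‖ < R / 2 := by
    refine lt_of_le_of_ne hxy1 fun h => ?_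
    rw [h, hκR] at hpos'
    linarith
  have hlt2 : ‖x - y‖ < R / 4 := by
    refine lt_of_le_of_ne hxy2 fun h => ?_
    rw [h, hψR] at hpos'
    linarith
  obtain ⟨t, ht⟩ : ∃ t, t = ‖x - y‖ := ⟨_, rfl⟩
  have ht0 : 0 < t := by
    rw [ht]
    refine norm_pos_iff.2 fun h => ?_
    rw [sub_eq_zero] at h
    rw [h] at hpos' hκx
    simp only [sub_self, norm_zero, hψ] at hpos'
    linarith
  obtain ⟨e, he⟩ : ∃ e, e = t⁻¹ • (x - y) := ⟨_, rfl⟩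
  have he1 : ‖e‖ = 1 := by
    rw [he, norm_smul, ← ht, Real.norm_of_nonneg (by positivity)]; field_simp
  have hte : t • e = x - y := by rw [he, smul_smul, mul_inv_cancel₀ ht0.ne', one_smul]
  rw [← ht] at hlt2
  obtain ⟨r, hr0, hr1, hr2, hr3⟩ : ∃ r : ℝ, 0 < r ∧ 2 * r ≤ t / 2 ∧ 2 * r ≤ R / 4 - t ∧
      r ≤ R / 2 - ‖x - c‖ := by
    refine ⟨min (t / 4) (min ((R / 4 - t) / 2) (R / 2 - ‖x - c‖)), ?_, ?_, ?_, ?_⟩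
    · exact lt_min (by linarith) (lt_min (by linarith) (by linarith))
    · linarith [min_le_left (t / 4) (min ((R / 4 - t) / 2) (R / 2 - ‖x - c‖))]
    · linarith [(min_le_right (t / 4) (min ((R / 4 - t) / 2) (R / 2 - ‖x - c‖))).trans
        (min_le_left _ _)]
    · exact (min_le_right _ _).trans (min_le_right _ _)
  have hloc : ∀ x' ∈ closedBall x r, ∀ y' ∈ closedBall y r, (x', y') ∈ K := by
    intro x' hx' y' hy'
    rw [mem_closedBall, dist_eq_norm] at hx' hy'
    refine ⟨?_, ?_⟩
    · have : x' - c = (x' - x) + (x - c) := by abel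
      simp only [this]
      exact (norm_add_le _ _).trans (by linarith)
    · have : x' - y' = (x' - x) + (x - y) - (y' - y) := by abel
      simp only [this]
      refine (norm_sub_le _ _).trans ?_
      have := norm_add_le (x' - x) (x - y)
      linarith
  have hsubx : closedBall x r ⊆ closedBall c R := fun x' hx' =>
    hball (hKsub _ (hloc x' hx' y (mem_closedBall_self hr0.le))).1
  have hsuby : closedBall y r ⊆ closedBall c R := fun y' hy' =>
    hball (hKsub _ (hloc x (mem_closedBall_self hr0.le) y' hy')).2
  have hquad := exists_touching_of_penalised_max (W₁ := w) (W₂ := fun y => -w y) (c₁ := x)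
    (c₂ := y) hr0 (hw.mono hsubx) (hw.mono hsuby).neg
    (l₁ := (L * (1 - 4 * t / R)) • innerSL ℝ e + (2 * κ) • innerSL ℝ (x - c))
    (l₂ := -((L * (1 - 4 * t / R)) • innerSL ℝ e)) (A := L * (1 / t - 2 / R)) (β := L * (1 / t))
    (κ := κ) (e := e) (by
      intro x' hx' y' hy'
      have h1 : Θ (x', y') ≤ Θ (x, y) := hxymax (hloc x' hx' y' hy')
      simp only [hΘ, ← ht] at h1
      rw [mem_closedBall, dist_eq_norm] at hx' hy'
      set η : Euc n := (x' - x) - (y' - y) with hη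
      have hηn : ‖η‖ ≤ t / 2 := (norm_sub_le _ _).trans (by linarith)
      have hxye : x' - y' = t • e + η := by rw [hte, hη]; abel
      have h2 := norm_smul_add_le_of_unit ht0 he1 hηn
      have h3 : ‖t • e + η‖ ^ 2 = t ^ 2 + 2 * t * ⟪e, η⟫ + ‖η‖ ^ 2 := by
        rw [norm_add_sq_real, norm_smul, he1, Real.norm_of_nonneg ht0.le, real_inner_smul_left]
        ring
      have h4 : ψ ‖x' - y'‖ ≤ ψ t + (1 - 4 * t / R) * ⟪e, η⟫ + (1 / t - 2 / R) * ‖η‖ ^ 2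
          - 1 / t * ⟪e, η⟫ ^ 2 := by
        simp only [hψ]
        rw [hxye, h3]
        have : (‖η‖ ^ 2 - ⟪e, η⟫ ^ 2) / t = 1 / t * ‖η‖ ^ 2 - 1 / t * ⟪e, η⟫ ^ 2 := by ring
        rw [this] at h2
        have h5 : (1 - 4 * t / R) * ⟪e, η⟫ = ⟪e, η⟫ - 2 / R * (2 * t * ⟪e, η⟫) := by ring
        rw [h5]
        linarith
      have h5 := mul_le_mul_of_nonneg_left h4 hL0.le
      have h6 : ‖x' - c‖ ^ 2 = ‖x - c‖ ^ 2 + 2 * ⟪x - c, x' - x⟫ + ‖x' - x‖ ^ 2 := by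
        rw [← norm_add_sq_real]; congr 2; abel
      have h7 : ⟪e, η⟫ = ⟪e, x' - x⟫ - ⟪e, y' - y⟫ := by rw [hη, inner_sub_right]
      rw [h6] at h1
      simp only [add_apply, neg_apply, smul_apply, innerSL_apply_apply, smul_eq_mul]
      have h8 : L * (1 - 4 * t / R) * ⟪e, x' - x⟫ - L * (1 - 4 * t / R) * ⟪e, y' - y⟫
          = L * ((1 - 4 * t / R) * ⟪e, η⟫) := by rw [h7]; ring
      linarith) hκ0
  obtain ⟨a, ha, b, hb, p, q, X, Y, hX, hY, hXY⟩ := hquad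
  have hF1 := hsub a (hsubx (ball_subset_closedBall ha)) p X hX
  have hF2 := hsup b (hsuby (ball_subset_closedBall hb)) (-q) (-Y) (by
    filter_upwards [hY] with h hh
    simp only [neg_apply]
    linarith)
  have hF3 := hF.le_of_form_le hlb.le hub.le (X := X) (Y := -Y) (C := 4 * κ) (m := 16 * L / R)
    (by positivity) (fun h => by
      have h1 := hXY h h
      simp only [sub_self, norm_zero, inner_zero_right] at h1
      simp only [neg_apply]
      linarith) he1 (by
      have h1 := hXY e (-e)
      have h2 : e - -e = (2 : ℝ) • e := by rw [sub_neg_eq_add, two_smul]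
      have h3 : (-Y) e e = -(Y e e) := rfl
      have h6 : Y (-e) (-e) = Y e e := by rw [map_neg, map_neg, neg_apply, neg_neg]
      have h4 : L * (1 / t - 2 / R) = L * (1 / t) - 2 * (L / R) := by ring
      have h5 : 16 * L / R = 16 * (L / R) := by ring
      rw [h2, norm_smul, he1, norm_neg, real_inner_smul_right, real_inner_self_eq_norm_sq, he1,
        Real.norm_of_nonneg (by norm_num), h6, h4] at h1
      rw [h3, h5]
      linarith)
  have h4 : lb * (16 * L / R) = 144 * (ub * S / R ^ 2) := by rw [hL]; field_simp; norm_num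
  have h5 : ub * (4 * κ) = 20 * (ub * S / R ^ 2) := by rw [hκ]; ring
  have h6 : 0 < ub * S / R ^ 2 := by positivity
  linarith

end InteriorLipschitz

section Barrier

open Filter Topology

lemma cubic_le_inv_one_add_pow {τ : ℝ} (hτ : 0 < 1 + τ) (m : ℕ) :
    1 - m * τ + m * (m + 1) / 2 * τ ^ 2 - m * (m + 1) * (m + 2) / 6 * τ ^ 3
      ≤ ((1 + τ) ^ m)⁻¹ := by
  induction m with
  | zero => simp
  | succ m ih =>
    rw [pow_succ (1 + τ) m, mul_inv, ← div_eq_mul_inv, le_div_iff₀ hτ]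
    refine le_trans ?_ ih
    push_cast
    have h : 0 ≤ ((m : ℝ) + 1) * (m + 2) * (m + 3) / 6 * τ ^ 4 := by positivity
    nlinarith

lemma eventually_quadratic_le_inv_norm_sq_pow {E : Type*} [NormedAddCommGroup E]
    [InnerProductSpace ℝ E] (m : ℕ) {z : E} (hz : z ≠ 0) {ε : ℝ} (hε : 0 < ε) :
    ∀ᶠ h in 𝓝 (0 : E), ((‖z‖ ^ 2) ^ m)⁻¹ * (1 - 2 * m / ‖z‖ ^ 2 * ⟪z, h⟫
      + 1 / 2 * (-(2 * m / ‖z‖ ^ 2 + ε) * ‖h‖ ^ 2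
        + 4 * m * (m + 1) / (‖z‖ ^ 2) ^ 2 * ⟪z, h⟫ ^ 2)) ≤ ((‖z + h‖ ^ 2) ^ m)⁻¹ := by
  have hz0 : 0 < ‖z‖ := norm_pos_iff.2 hz
  obtain ⟨s, hs⟩ : ∃ s, s = ‖z‖ ^ 2 := ⟨_, rfl⟩
  have hs0 : 0 < s := by rw [hs]; positivity
  obtain ⟨C, hC⟩ : ∃ C, C = m * (m + 1) / 2 * (4 * ‖z‖ / s ^ 2)
      + m * (m + 1) * (m + 2) / 6 * ((2 * ‖z‖ + 1) / s) ^ 3 := ⟨_, rfl⟩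
  have hC0 : 0 ≤ C := by rw [hC]; positivity
  have hev : ∀ᶠ h in 𝓝 (0 : E), ‖h‖ < min (min ‖z‖ 1) (ε / 2 / (C + 1)) := by
    have : Tendsto (fun h : E => ‖h‖) (𝓝 0) (𝓝 0) := tendsto_norm_zero
    exact this.eventually (gt_mem_nhds (lt_min (lt_min hz0 one_pos) (by positivity)))
  filter_upwards [hev] with h hh
  rw [lt_min_iff, lt_min_iff] at hh
  obtain ⟨⟨hhz, hh1⟩, hhε⟩ := hh
  rw [← hs]
  obtain ⟨i, hi⟩ : ∃ i, i = ⟪z, h⟫ := ⟨_, rfl⟩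
  obtain ⟨k, hk⟩ : ∃ k, k = ‖h‖ := ⟨_, rfl⟩
  have hk0 : 0 ≤ k := by rw [hk]; exact norm_nonneg _
  have hik : |i| ≤ ‖z‖ * k := by rw [hi, hk]; exact abs_real_inner_le_norm _ _
  rw [← hi, ← hk]
  rw [← hk] at hhz hh1 hhε
  obtain ⟨τ, hτ⟩ : ∃ τ, τ = (2 * i + k ^ 2) / s := ⟨_, rfl⟩
  have hτs : ‖z + h‖ ^ 2 = s * (1 + τ) := by
    rw [norm_add_sq_real, ← hi, ← hk, ← hs, hτ]; field_simp; ring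
  have hτ1 : 0 < 1 + τ := by
    have h1 : 0 < ‖z + h‖ := by
      have := norm_sub_norm_le z (-h)
      rw [norm_neg, sub_neg_eq_add, ← hk] at this
      linarith
    have h2 : 0 < s * (1 + τ) := by rw [← hτs]; positivity
    exact pos_of_mul_pos_right h2 hs0.le
  rw [hτs, mul_pow, mul_inv]
  refine mul_le_mul_of_nonneg_left ?_ (by positivity)
  refine le_trans ?_ (cubic_le_inv_one_add_pow hτ1 m)
  have hτsq : 4 * i ^ 2 / s ^ 2 - 4 * ‖z‖ / s ^ 2 * k ^ 3 ≤ τ ^ 2 := by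
    have h1 : τ ^ 2 = 4 * i ^ 2 / s ^ 2 + (4 * i * k ^ 2 + k ^ 4) / s ^ 2 := by
      rw [hτ]; field_simp; ring
    have h2 : -(4 * ‖z‖ * k ^ 3) ≤ 4 * i * k ^ 2 + k ^ 4 := by
      have h3 := (abs_le.1 hik).1
      have h4 : -(‖z‖ * k) * k ^ 2 ≤ i * k ^ 2 := by gcongr
      have h5 : 0 ≤ k ^ 4 := by positivity
      linarith
    have h3 : -(4 * ‖z‖ * k ^ 3) / s ^ 2 ≤ (4 * i * k ^ 2 + k ^ 4) / s ^ 2 := by gcongr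
    rw [h1]
    have h4 : -(4 * ‖z‖ * k ^ 3) / s ^ 2 = -(4 * ‖z‖ / s ^ 2 * k ^ 3) := by ring
    rw [h4] at h3
    linarith
  have hτcu : τ ^ 3 ≤ ((2 * ‖z‖ + 1) / s) ^ 3 * k ^ 3 := by
    have h1 : |τ| ≤ (2 * ‖z‖ + 1) / s * k := by
      rw [hτ, abs_div, abs_of_pos hs0, div_mul_eq_mul_div]
      gcongr
      have h2 : |2 * i + k ^ 2| ≤ |2 * i| + |k ^ 2| := abs_add_le _ _
      rw [abs_mul, abs_two, abs_of_nonneg (sq_nonneg k)] at h2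
      nlinarith
    have h2 : τ ^ 3 ≤ |τ| ^ 3 := by rw [← abs_pow]; exact le_abs_self _
    rw [← mul_pow]
    exact h2.trans (by gcongr)
  have hm1 : (0 : ℝ) ≤ m * (m + 1) / 2 := by positivity
  have hm2 : (0 : ℝ) ≤ m * (m + 1) * (m + 2) / 6 := by positivity
  have h1 := mul_le_mul_of_nonneg_left hτsq hm1
  have h2 := mul_le_mul_of_nonneg_left hτcu hm2
  have h3 : C * k ^ 3 ≤ ε / 2 * k ^ 2 := by
    have h4 : C * k ≤ ε / 2 := by
      have := (lt_div_iff₀ (by positivity)).1 hhε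
      nlinarith
    have h5 : C * k ^ 3 = C * k * k ^ 2 := by ring
    rw [h5]; gcongr
  have h4 : C * k ^ 3 = m * (m + 1) / 2 * (4 * ‖z‖ / s ^ 2 * k ^ 3)
      + m * (m + 1) * (m + 2) / 6 * (((2 * ‖z‖ + 1) / s) ^ 3 * k ^ 3) := by rw [hC]; ring
  have h5 : (m : ℝ) * τ = 2 * m / s * i + m / s * k ^ 2 := by rw [hτ]; ring
  have h6 : (m : ℝ) * (m + 1) / 2 * (4 * i ^ 2 / s ^ 2) = 2 * m * (m + 1) / s ^ 2 * i ^ 2 := by ring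
  have h7 : 1 / 2 * (-(2 * m / s + ε) * k ^ 2 + 4 * m * (m + 1) / s ^ 2 * i ^ 2)
      = -(m / s * k ^ 2) - ε / 2 * k ^ 2 + 2 * m * (m + 1) / s ^ 2 * i ^ 2 := by ring
  rw [h7, h5]
  linarith

variable {n : ℕ}

lemma formMatrix_zero : formMatrix (0 : Euc n →L[ℝ] Euc n →L[ℝ] ℝ) = 0 := by
  ext i j
  simp [formMatrix]

/-- Comparison on an annulus of a supersolution with the fundamental-type barrier `|x - c|^(-2m)`. -/
lemma UniformlyElliptic.barrier_le_of_supersolution {F : Matrix (Fin n) (Fin n) ℝ → ℝ} {lb ub : ℝ}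
    (hF : UniformlyElliptic F lb ub) (hF0 : F 0 = 0) (hlb : 0 < lb) (hle : lb ≤ ub) {m : ℕ}
    (hm : ub < lb * (m + 1)) {v : Euc n → ℝ} {c : Euc n} {r R N : ℝ} (hr : 0 < r) (hN : 0 < N)
    (hv : ContinuousOn v (closedBall c R)) (hv0 : ∀ x ∈ closedBall c R, 0 ≤ v x)
    (hvN : ∀ x, ‖x - c‖ = r → N * ((r ^ 2) ^ m)⁻¹ ≤ v x)
    (hsup : ∀ a, r < ‖a - c‖ → ‖a - c‖ < R →
      ∀ (l : Euc n →L[ℝ] ℝ) (b : Euc n →L[ℝ] Euc n →L[ℝ] ℝ),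
      (∀ᶠ h in 𝓝 (0 : Euc n), v a + (l h + 1 / 2 * b h h) ≤ v (a + h)) → F (formMatrix b) ≤ 0)
    {x : Euc n} (hxr : r ≤ ‖x - c‖) (hxR : ‖x - c‖ ≤ R) :
    N * (((‖x - c‖ ^ 2) ^ m)⁻¹ - ((R ^ 2) ^ m)⁻¹) ≤ v x := by
  have hub : 0 < ub := hlb.trans_le hle
  have hm0 : (0 : ℝ) < m := by
    by_contra! h
    nlinarith
  set A : Set (Euc n) := {y | r ≤ ‖y - c‖ ∧ ‖y - c‖ ≤ R} with hA
  have hAsub : A ⊆ closedBall c R := fun y hy => by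
    rw [mem_closedBall, dist_eq_norm]; exact hy.2
  have hAcl : IsClosed A :=
    (isClosed_le (g := fun y : Euc n => ‖y - c‖) continuous_const (by fun_prop)).inter
      (isClosed_le (f := fun y : Euc n => ‖y - c‖) (by fun_prop) continuous_const)
  have hAc : IsCompact A := (isCompact_closedBall c R).of_isClosed_subset hAcl hAsub
  set f : Euc n → ℝ := fun y => v y - N * ((‖y - c‖ ^ 2) ^ m)⁻¹ with hf
  have hpos : ∀ y ∈ A, 0 < ‖y - c‖ := fun y hy => hr.trans_le hy.1
  have hfc : ContinuousOn f A := by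
    refine (hv.mono hAsub).sub (continuousOn_const.mul (ContinuousOn.inv₀ ?_ fun y hy => ?_))
    · exact Continuous.continuousOn (by fun_prop)
    · have := hpos y hy
      positivity
  obtain ⟨y, hyA, hymin⟩ := hAc.exists_isMinOn ⟨x, hxr, hxR⟩ hfc
  have hxy : f y ≤ f x := hymin ⟨hxr, hxR⟩
  have hR0 : 0 ≤ N * ((R ^ 2) ^ m)⁻¹ := by positivity
  suffices hfy : -(N * ((R ^ 2) ^ m)⁻¹) ≤ f y by
    simp only [hf] at hxy hfy
    linarith
  rcases eq_or_lt_of_le hyA.1 with hy1 | hy1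
  · have h1 := hvN y hy1.symm
    simp only [hf]
    rw [← hy1]
    linarith
  rcases eq_or_lt_of_le hyA.2 with hy2 | hy2
  · have h1 := hv0 y (hAsub hyA)
    simp only [hf]
    rw [hy2]
    linarith
  exfalso
  obtain ⟨z, hz⟩ : ∃ z, z = y - c := ⟨_, rfl⟩
  have hz0 : 0 < ‖z‖ := by rw [hz]; exact hpos y hyA
  obtain ⟨s, hs⟩ : ∃ s, s = ‖z‖ ^ 2 := ⟨_, rfl⟩
  have hs0 : 0 < s := by rw [hs]; positivity
  obtain ⟨γ, hγ⟩ : ∃ γ, γ = N * (s ^ m)⁻¹ := ⟨_, rfl⟩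
  have hγ0 : 0 < γ := by rw [hγ]; positivity
  have hbar := eventually_quadratic_le_inv_norm_sq_pow m (norm_pos_iff.1 hz0)
    (ε := 2 * m / s) (by positivity)
  rw [← hs] at hbar
  obtain ⟨S, hS⟩ : ∃ S : Euc n →L[ℝ] Euc n →L[ℝ] ℝ, ∀ h, S h h = ‖h‖ ^ 2 :=
    ⟨innerSL ℝ, fun h => by rw [innerSL_apply_apply, real_inner_self_eq_norm_sq]⟩
  obtain ⟨Q, hQ⟩ : ∃ Q : Euc n →L[ℝ] Euc n →L[ℝ] ℝ, ∀ h, Q h h = ⟪z, h⟫ ^ 2 :=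
    ⟨(ContinuousLinearMap.mul ℝ ℝ).bilinearComp (innerSL ℝ z) (innerSL ℝ z), fun h => by
      rw [ContinuousLinearMap.bilinearComp_apply, innerSL_apply_apply,
        ContinuousLinearMap.mul_apply', sq]⟩
  set T : Euc n →L[ℝ] Euc n →L[ℝ] ℝ :=
    (-(γ * (4 * m / s))) • S + (γ * (4 * m * (m + 1) / s ^ 2)) • Q with hT
  have hTh : ∀ h, T h h = -(γ * (4 * m / s)) * ‖h‖ ^ 2
      + γ * (4 * m * (m + 1) / s ^ 2) * ⟪z, h⟫ ^ 2 := fun h => by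
    simp only [hT, add_apply, smul_apply, smul_eq_mul, hS, hQ]
  have hAn : ∀ᶠ h in 𝓝 (0 : Euc n), y + h ∈ A := by
    have hcont : Tendsto (fun h : Euc n => ‖y + h - c‖) (𝓝 0) (𝓝 ‖y - c‖) := by
      have : Tendsto (fun h : Euc n => ‖y + h - c‖) (𝓝 0) (𝓝 ‖y + 0 - c‖) :=
        Continuous.tendsto (by fun_prop) 0
      rwa [add_zero] at this
    filter_upwards [hcont.eventually (lt_mem_nhds hy1), hcont.eventually (gt_mem_nhds hy2)]
      with h h1 h2
    exact ⟨h1.le, h2.le⟩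
  have hF1 := hsup y hy1 hy2 ((-(γ * (2 * m / s))) • innerSL ℝ z) T (by
    filter_upwards [hAn, hbar] with h h1 h2
    have h3 : f y ≤ f (y + h) := hymin h1
    have e : y + h - c = z + h := by rw [hz]; abel
    simp only [hf, e, ← hz, ← hs] at h3
    have h4 := mul_le_mul_of_nonneg_left h2 hN.le
    rw [← mul_assoc, ← hγ] at h4
    rw [hTh, smul_apply, innerSL_apply_apply, smul_eq_mul]
    have h5 : γ * (1 - 2 * m / s * ⟪z, h⟫ + 1 / 2 * (-(2 * m / s + 2 * m / s) * ‖h‖ ^ 2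
        + 4 * m * (m + 1) / s ^ 2 * ⟪z, h⟫ ^ 2))
        = γ + (-(γ * (2 * m / s)) * ⟪z, h⟫ + 1 / 2 * (-(γ * (4 * m / s)) * ‖h‖ ^ 2
          + γ * (4 * m * (m + 1) / s ^ 2) * ⟪z, h⟫ ^ 2)) := by ring
    rw [h5] at h4
    rw [← hγ] at h3
    linarith)
  obtain ⟨e, he⟩ : ∃ e, e = ‖z‖⁻¹ • z := ⟨_, rfl⟩
  have he1 : ‖e‖ = 1 := by
    rw [he, norm_smul, norm_inv, norm_norm]; field_simp
  have hze : ⟪z, e⟫ ^ 2 = s := by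
    rw [he, real_inner_smul_right, real_inner_self_eq_norm_sq, hs]; field_simp
  have hF2 := hF.le_of_form_le hlb.le hub.le (X := 0) (Y := T) (C := γ * (4 * m / s))
    (m := γ * (4 * m * (m + 1) / s ^ 2) * s) (by positivity) (fun h => by
      have h1 : (0 : Euc n →L[ℝ] Euc n →L[ℝ] ℝ) h h = 0 := rfl
      have h2 : 0 ≤ γ * (4 * m * (m + 1) / s ^ 2) * ⟪z, h⟫ ^ 2 := by positivity
      rw [h1, hTh]
      linarith) he1 (by
      have h1 : (0 : Euc n →L[ℝ] Euc n →L[ℝ] ℝ) e e = 0 := rfl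
      rw [h1, hTh, hze, he1]
      linarith)
  rw [formMatrix_zero, hF0] at hF2
  have h1 : lb * (γ * (4 * m * (m + 1) / s ^ 2) * s) - ub * (γ * (4 * m / s))
      = γ * (4 * m / s) * (lb * (m + 1) - ub) := by field_simp
  have h2 : 0 < γ * (4 * m / s) * (lb * (m + 1) - ub) :=
    mul_pos (by positivity) (by linarith)
  linarith

end Barrier

section ContactPoint

open Filter Topology

variable {n : ℕ}

/-- The constant in the Harnack type estimate
`UniformlyElliptic.mul_le_of_supersolution_of_solution`. -/
def contactConst (lb ub : ℝ) (m : ℕ) : ℝ :=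
  1 / 2 * ((lb / (36 * ub * 4 ^ m)) ^ 2) ^ m * ((4 / 9) ^ m - (1 / 4) ^ m) * (1 / 4) ^ m

lemma contactConst_pos {lb ub : ℝ} (hlb : 0 < lb) (hub : 0 < ub) {m : ℕ} (hm : m ≠ 0) :
    0 < contactConst lb ub m := by
  have h : (1 / 4 : ℝ) ^ m < (4 / 9) ^ m := pow_lt_pow_left₀ (by norm_num) (by norm_num) hm
  have h' := sub_pos.2 h
  unfold contactConst
  positivity

theorem UniformlyElliptic.mul_le_of_supersolution_of_solution
    {F : Matrix (Fin n) (Fin n) ℝ → ℝ} {lb ub : ℝ} (hF : UniformlyElliptic F lb ub)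
    (hF0 : F 0 = 0) (hlb : 0 < lb) (hle : lb ≤ ub) {m : ℕ} (hm : ub < lb * (m + 1))
    {v : Euc n → ℝ} {x₀ x₁ : Euc n} (hne : x₁ ≠ x₀)
    (hv : ContinuousOn v (ball x₀ (4 * ‖x₁ - x₀‖)))
    (hv0 : ∀ x ∈ ball x₀ (4 * ‖x₁ - x₀‖), 0 ≤ v x)
    (hsub : ∀ a ∈ ball x₁ ‖x₁ - x₀‖, ∀ (l : Euc n →L[ℝ] ℝ) (b : Euc n →L[ℝ] Euc n →L[ℝ] ℝ),
      (∀ᶠ h in 𝓝 0, v (a + h) ≤ v a + (l h + 1 / 2 * b h h)) → 0 ≤ F (formMatrix b))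
    (hsup : ∀ a ∈ ball x₀ (4 * ‖x₁ - x₀‖), ∀ (l : Euc n →L[ℝ] ℝ)
      (b : Euc n →L[ℝ] Euc n →L[ℝ] ℝ),
      (∀ᶠ h in 𝓝 0, v a + (l h + 1 / 2 * b h h) ≤ v (a + h)) → F (formMatrix b) ≤ 0) :
    contactConst lb ub m * v x₁ ≤ v x₀ := by
  obtain ⟨ρ, hρ⟩ : ∃ ρ, ρ = ‖x₁ - x₀‖ := ⟨_, rfl⟩
  have hρ0 : 0 < ρ := by rw [hρ]; exact norm_pos_iff.2 (sub_ne_zero.2 hne)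
  have hub : 0 < ub := hlb.trans_le hle
  rw [← hρ] at hv hv0 hsub hsup
  have hm0 : m ≠ 0 := by
    rintro rfl
    simp only [Nat.cast_zero, zero_add, mul_one] at hm
    linarith
  have hmem : ∀ x, ‖x - x₁‖ ≤ ρ → x ∈ ball x₀ (4 * ρ) := fun x hx => by
    rw [mem_ball, dist_eq_norm]
    have := norm_sub_le_norm_sub_add_norm_sub x x₁ x₀
    linarith
  have hx₁ : 0 ≤ v x₁ := hv0 x₁ (hmem x₁ (by simpa using hρ0.le))
  have hx₀ : 0 ≤ v x₀ := hv0 x₀ (mem_ball_self (by linarith))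
  rcases hx₁.eq_or_lt with hz | hpos
  · rwa [← hz, mul_zero]
  obtain ⟨y, hy, hymax⟩ := (isCompact_closedBall x₁ (ρ / 2)).exists_isMaxOn
    (f := fun x => v x * ((ρ / 2 - ‖x - x₁‖) ^ 2) ^ m) ⟨x₁, mem_closedBall_self (by linarith)⟩
    ((hv.mono fun x hx => hmem x (by
      rw [mem_closedBall, dist_eq_norm] at hx; linarith)).mul (by fun_prop))
  rw [mem_closedBall, dist_eq_norm] at hy
  obtain ⟨d, hd⟩ : ∃ d, d = ρ / 2 - ‖y - x₁‖ := ⟨_, rfl⟩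
  have hd0' : 0 ≤ d := by linarith
  have hmax : ∀ x, ‖x - x₁‖ ≤ ρ / 2 →
      v x * ((ρ / 2 - ‖x - x₁‖) ^ 2) ^ m ≤ v y * (d ^ 2) ^ m := fun x hx => by
    rw [hd]
    exact hymax (by rwa [mem_closedBall, dist_eq_norm] : x ∈ closedBall x₁ (ρ / 2))
  have hM1 : v x₁ * ((ρ / 2) ^ 2) ^ m ≤ v y * (d ^ 2) ^ m := by
    simpa using hmax x₁ (by simpa using (half_pos hρ0).le)
  have hM1pos : 0 < v y * (d ^ 2) ^ m := lt_of_lt_of_le (by positivity) hM1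
  have hy0 : 0 ≤ v y := hv0 y (hmem y (by linarith))
  have hM : 0 < v y := hy0.lt_of_ne fun h => by simp [← h] at hM1pos
  have hd0 : 0 < d := hd0'.lt_of_ne fun h => by simp [← h, hm0] at hM1pos
  have hdρ : d ≤ ρ / 2 := by linarith [norm_nonneg (y - x₁)]
  have hnear : ∀ x ∈ closedBall y (d / 2), ‖x - x₁‖ ≤ ρ / 2 - d / 2 := fun x hx => by
    rw [mem_closedBall, dist_eq_norm] at hx
    have := norm_sub_le_norm_sub_add_norm_sub x y x₁
    linarith
  have hS : ∀ x ∈ closedBall y (d / 2), v x ≤ 4 ^ m * v y := fun x hx => by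
    have h1 := hnear x hx
    have h2 := hmax x (by linarith)
    have h3 : v x * ((d / 2) ^ 2) ^ m ≤ v x * ((ρ / 2 - ‖x - x₁‖) ^ 2) ^ m := by
      have := hv0 x (hmem x (by linarith))
      gcongr
      linarith
    have h4 : (d ^ 2) ^ m = 4 ^ m * ((d / 2) ^ 2) ^ m := by
      rw [← mul_pow]; congr 1; ring
    rw [h4] at h2
    have h5 : 0 < ((d / 2) ^ 2) ^ m := by positivity
    refine le_of_mul_le_mul_right ?_ h5
    linarith
  obtain ⟨c, hc⟩ : ∃ c, c = lb / (36 * ub * 4 ^ m) := ⟨_, rfl⟩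
  have hc0 : 0 < c := by rw [hc]; positivity
  have hc1 : c ≤ 1 / 36 := by
    rw [hc, div_le_div_iff₀ (by positivity) (by norm_num)]
    have : (1 : ℝ) ≤ 4 ^ m := one_le_pow₀ (by norm_num)
    nlinarith
  have hball : ∀ x, ‖x - y‖ = c * d → v y / 2 ≤ v x := fun x hx => by
    have h := hF.sub_le_of_solution hlb hle (w := v) (c := y) (R := d / 2) (S := 4 ^ m * v y)
      (by positivity) (by positivity)
      (hv.mono fun x hx => hmem x (by linarith [hnear x hx]))
      (fun x hx => hv0 x (hmem x (by linarith [hnear x hx]))) hS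
      (fun a ha => hsub a (by rw [mem_ball, dist_eq_norm]; linarith [hnear a ha]))
      (fun a ha => hsup a (hmem a (by linarith [hnear a ha])))
      (z := x) (by rw [hx]; nlinarith)
    have h1 : 9 * (ub / lb) * (4 ^ m * v y) / (d / 2) * ‖x - y‖ = v y / 2 := by
      rw [hx, hc]; field_simp; norm_num
    linarith
  have hyx₀ : ‖y - x₀‖ ≤ 3 / 2 * ρ := by
    have := norm_sub_le_norm_sub_add_norm_sub y x₁ x₀
    linarith
  have hyx₀' : ρ / 2 ≤ ‖x₀ - y‖ := by
    have := norm_sub_le_norm_sub_add_norm_sub x₁ y x₀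
    rw [norm_sub_rev x₁ y, norm_sub_rev y x₀] at this
    linarith
  have hbig : ∀ x, ‖x - y‖ ≤ 2 * ρ → x ∈ ball x₀ (4 * ρ) := fun x hx => by
    rw [mem_ball, dist_eq_norm]
    have := norm_sub_le_norm_sub_add_norm_sub x y x₀
    linarith
  have hbar := hF.barrier_le_of_supersolution hF0 hlb hle hm (v := v) (c := y) (r := c * d)
    (R := 2 * ρ) (N := v y / 2 * ((c * d) ^ 2) ^ m) (by positivity) (by positivity)
    (hv.mono fun x hx => hbig x (by rwa [mem_closedBall, dist_eq_norm] at hx))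
    (fun x hx => hv0 x (hbig x (by rwa [mem_closedBall, dist_eq_norm] at hx)))
    (fun x hx => by
      rw [mul_assoc, mul_inv_cancel₀ (by positivity), mul_one]
      exact hball x hx)
    (fun a _ ha => hsup a (hbig a ha.le)) (x := x₀) (by nlinarith)
    (by rw [norm_sub_rev]; linarith)
  refine le_trans ?_ hbar
  have hq0 : 0 < ‖x₀ - y‖ := by linarith
  have hinv : (4 / 9) ^ m * ((ρ ^ 2) ^ m)⁻¹ ≤ ((‖x₀ - y‖ ^ 2) ^ m)⁻¹ := by
    have h1 : (4 / 9 : ℝ) ^ m * ((ρ ^ 2) ^ m)⁻¹ = (((3 / 2 * ρ) ^ 2) ^ m)⁻¹ := by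
      rw [show (3 / 2 * ρ) ^ 2 = (4 / 9)⁻¹ * ρ ^ 2 by ring, mul_pow, mul_inv, inv_pow, inv_inv]
    rw [h1, norm_sub_rev]
    rw [norm_sub_rev] at hq0
    gcongr
  have hinv' : (((2 * ρ) ^ 2) ^ m)⁻¹ = (1 / 4) ^ m * ((ρ ^ 2) ^ m)⁻¹ := by
    rw [show (2 * ρ) ^ 2 = (1 / 4)⁻¹ * ρ ^ 2 by ring, mul_pow, mul_inv, inv_pow, inv_inv]
  have hgap : (0 : ℝ) ≤ (4 / 9) ^ m - (1 / 4) ^ m :=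
    sub_nonneg.2 (pow_le_pow_left₀ (by norm_num) (by norm_num) m)
  have hM2 : (1 / 4) ^ m * v x₁ ≤ v y * (d ^ 2) ^ m * ((ρ ^ 2) ^ m)⁻¹ := by
    rw [← div_eq_mul_inv, le_div_iff₀ (by positivity)]
    refine le_trans (le_of_eq ?_) hM1
    rw [show (ρ / 2) ^ 2 = 1 / 4 * ρ ^ 2 by ring, mul_pow]
    ring
  calc contactConst lb ub m * v x₁
      = 1 / 2 * (c ^ 2) ^ m * ((4 / 9) ^ m - (1 / 4) ^ m) * ((1 / 4) ^ m * v x₁) := by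
        rw [contactConst, ← hc]; ring
    _ ≤ 1 / 2 * (c ^ 2) ^ m * ((4 / 9) ^ m - (1 / 4) ^ m)
          * (v y * (d ^ 2) ^ m * ((ρ ^ 2) ^ m)⁻¹) := by gcongr
    _ = v y / 2 * ((c * d) ^ 2) ^ m
          * ((4 / 9) ^ m * ((ρ ^ 2) ^ m)⁻¹ - (1 / 4) ^ m * ((ρ ^ 2) ^ m)⁻¹) := by
        rw [mul_pow c d, mul_pow (c ^ 2)]; ring
    _ ≤ _ := by rw [hinv']; gcongr

end ContactPoint

/-- Fully nonlinear version: quadratic growth of `u` above a linear part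
of a quadratically semiconvex obstacle at a closest contact point. -/
theorem fully_nonlinear_quadratic_growth_above_linear_part
    (n : ℕ) (lb ub Cbar : ℝ) (hlb : 0 < lb) (hle : lb ≤ ub) (hCbar : 0 ≤ Cbar) :
    ∃ K > 0, ∀ (F : Matrix (Fin n) (Fin n) ℝ → ℝ) (Ω : Set (Euc n))
      (u φ : Euc n → ℝ) (x₀ x₁ p : Euc n),
      UniformlyElliptic F lb ub → F 0 = 0 → IsOpen Ω →
      SolvesObstacle F Ω u φ →
      SemiconvexWithModulus Ω φ (fun r => Cbar * r ^ 2) →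
      x₁ ∈ Ω → φ x₁ < u x₁ →
      x₀ ∈ Ω → u x₀ = φ x₀ →
      (∀ y ∈ Ω, u y = φ y → ‖x₁ - x₀‖ ≤ ‖x₁ - y‖) →
      ball x₀ (4 * ‖x₁ - x₀‖) ⊆ Ω →
      IsLinearPartSlope Ω φ (fun r => Cbar * r ^ 2) x₀ p →
      u x₁ - (φ x₀ + ⟪p, x₁ - x₀⟫) ≤ K * ‖x₁ - x₀‖ ^ 2 := by
  obtain ⟨m, hm⟩ : ∃ m : ℕ, ub < lb * (m + 1) := by
    obtain ⟨m, hm⟩ := exists_nat_gt (ub / lb)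
    rw [div_lt_iff₀' hlb] at hm
    exact ⟨m, hm.trans (by linarith)⟩
  have hm0 : m ≠ 0 := by
    rintro rfl
    simp only [Nat.cast_zero, zero_add, mul_one] at hm
    linarith
  have hκ := contactConst_pos hlb (hlb.trans_le hle) hm0
  refine ⟨16 * Cbar / contactConst lb ub m + 1, by positivity, ?_⟩
  intro F Ω u φ x₀ x₁ p hF hF0 _ ⟨hucont, huφ, husup, _, husub⟩ _ _ hx₁ _ hx₀ hclosest hball hp
  have hne : x₁ ≠ x₀ := by
    rintro rfl
    exact hx₁.ne' hx₀
  have hρ : 0 < ‖x₁ - x₀‖ := norm_pos_iff.2 (sub_ne_zero.2 hne)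
  have hshift : ∀ a h : Euc n, ⟪p, a + h - x₀⟫ = ⟪p, a - x₀⟫ + innerSL ℝ p h := fun a h => by
    rw [innerSL_apply_apply, ← inner_add_right]
    congr 1
    abel
  have key := hF.mul_le_of_supersolution_of_solution hF0 hlb hle hm hne
    (v := fun x => u x - (φ x₀ + ⟪p, x - x₀⟫) + 16 * Cbar * ‖x₁ - x₀‖ ^ 2)
    (((hucont.mono hball).sub (by fun_prop)).add (by fun_prop))
    (fun x hx => by
      have h1 := hp x (hball hx)
      have h2 := huφ x (hball hx)
      rw [mem_ball, dist_eq_norm] at hx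
      have h3 : Cbar * ‖x - x₀‖ ^ 2 ≤ Cbar * (4 * ‖x₁ - x₀‖) ^ 2 := by gcongr
      simp only at h1
      linarith)
    (fun a ha l b hab => by
      rw [mem_ball, dist_eq_norm] at ha
      have haΩ : a ∈ Ω := hball (by
        rw [mem_ball, dist_eq_norm]
        have := norm_sub_le_norm_sub_add_norm_sub a x₁ x₀
        linarith)
      refine husub.nonneg_of_quadratic (l := l + innerSL ℝ p)
        ⟨haΩ, (huφ a haΩ).lt_of_ne fun h => ?_⟩ ?_
      · have := hclosest a haΩ h.symm
        rw [norm_sub_rev x₁ a] at this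
        linarith
      · filter_upwards [hab] with h hh
        rw [hshift] at hh
        rw [add_apply]
        linarith)
    (fun a ha l b hab => by
      refine husup.nonpos_of_quadratic (l := l + innerSL ℝ p) (hball ha) ?_
      filter_upwards [hab] with h hh
      rw [hshift] at hh
      rw [add_apply]
      linarith)
  simp only [sub_self, inner_zero_right, add_zero, hx₀, zero_add] at key
  rw [← le_div_iff₀' hκ] at key
  have h1 : 0 ≤ 16 * Cbar * ‖x₁ - x₀‖ ^ 2 := by positivity
  have h2 : (16 * Cbar / contactConst lb ub m + 1) * ‖x₁ - x₀‖ ^ 2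
      = 16 * Cbar * ‖x₁ - x₀‖ ^ 2 / contactConst lb ub m + ‖x₁ - x₀‖ ^ 2 := by ring
  rw [h2]
  linarith [sq_nonneg ‖x₁ - x₀‖]
end
end

section
/- Let F be uniformly elliptic with constants 0 < λ ≤ Λ and let u solve the fully nonlinear obstacle problem in Ω with obstacle φ semiconvex with quadratic modulus of semiconvexity ω(r) = C̄r². Let x₀, x₁ ∈ {u = φ} be two contact points with ρ := |x₁ − x₀| and B_{4ρ}(x₀) ⊂ Ω. Then there is a constant K > 0 depending only on n, λ, Λ, C̄ such that u(x₁) − L_{x₀}(x₁) ≤ K·ρ², where L_{x₀} is a linear part of φ at x₀; equivalently φ(x₁) − φ(x₀) − ⟨p, x₁ − x₀⟩ ≤ K·ρ² for the slope p of L_{x₀}. -/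
open MeasureTheory Metric Set
open scoped RealInnerProductSpace

noncomputable section

/-- Every vector is its norm times some unit vector, provided a nonzero vector exists. -/
lemma exists_unit_smul_eq {E : Type*} [NormedAddCommGroup E] [NormedSpace ℝ E]
    {w : E} (hw : w ≠ 0) (q : E) : ∃ e : E, ‖e‖ = 1 ∧ q = ‖q‖ • e := by
  by_cases hq : q = 0
  · exact ⟨‖w‖⁻¹ • w, norm_smul_inv_norm (𝕜 := ℝ) hw, by simp [hq]⟩
  · refine ⟨‖q‖⁻¹ • q, norm_smul_inv_norm (𝕜 := ℝ) hq, ?_⟩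
    rw [smul_smul, mul_inv_cancel₀ (norm_ne_zero_iff.2 hq), one_smul]

/-- First derivative of an affine function plus a Gaussian. -/
lemma hasFDerivAt_affine_add_gaussian {E : Type*} [NormedAddCommGroup E]
    [InnerProductSpace ℝ E] (b a γ : ℝ) (p y x : E) :
    HasFDerivAt (fun x => b + ⟪p, x⟫ + a * Real.exp (-γ * ‖x - y‖ ^ 2))
      (innerSL ℝ p + (-(2 * γ * a) * Real.exp (-γ * ‖x - y‖ ^ 2)) • innerSL ℝ (x - y)) x := by
  have h1 : HasFDerivAt (fun x => ‖x - y‖ ^ 2) (2 • innerSL ℝ (x - y)) x := by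
    simpa using ((hasFDerivAt_id x).sub_const y).norm_sq
  have h2 := ((innerSL ℝ p).hasFDerivAt (x := x)).const_add b
  refine (h2.add (((h1.const_mul (-γ)).exp).const_mul a)).congr_fderiv ?_
  ext v
  simp
  ring

/-- Hessian of an affine function plus a Gaussian: a multiple of the identity plus a rank-one
matrix. -/
lemma hess2_affine_add_gaussian {n : ℕ} (b a γ : ℝ) (p y x : Euc n) :
    hess2 (fun x => b + ⟪p, x⟫ + a * Real.exp (-γ * ‖x - y‖ ^ 2)) x =
      -((2 * γ * (a * Real.exp (-γ * ‖x - y‖ ^ 2))) • (1 : Matrix (Fin n) (Fin n) ℝ)) +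
      (4 * γ ^ 2 * (a * Real.exp (-γ * ‖x - y‖ ^ 2))) •
        Matrix.vecMulVec (x - y).ofLp (x - y).ofLp := by
  have hd : fderiv ℝ (fun x => b + ⟪p, x⟫ + a * Real.exp (-γ * ‖x - y‖ ^ 2)) =
      fun x => innerSL ℝ p +
        (-(2 * γ * a) * Real.exp (-γ * ‖x - y‖ ^ 2)) • innerSL ℝ (x - y) :=
    funext fun x => (hasFDerivAt_affine_add_gaussian b a γ p y x).fderiv
  have h1 : HasFDerivAt (fun x => ‖x - y‖ ^ 2) (2 • innerSL ℝ (x - y)) x := by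
    simpa using ((hasFDerivAt_id x).sub_const y).norm_sq
  have h2 := ((h1.const_mul (-γ)).exp).const_mul (-(2 * γ * a))
  obtain ⟨B, hB⟩ : ∃ B : Euc n →L[ℝ] Euc n →L[ℝ] ℝ, ∀ v, B v = innerSL ℝ v :=
    ⟨innerSL ℝ, fun _ => rfl⟩
  have h3 : HasFDerivAt (fun x => B (x - y)) B x :=
    B.hasFDerivAt.comp x ((hasFDerivAt_id x).sub_const y)
  have h4 := (h2.fun_smul h3).const_add (innerSL ℝ p)
  simp only [hB] at h4
  ext i j
  rw [hess2, iteratedFDeriv_two_apply, hd, h4.fderiv]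
  simp [hB, Matrix.one_apply, Matrix.vecMulVec_apply, EuclideanSpace.inner_single_right,
    eq_comm (a := j)]
  split_ifs <;> ring

/-- The operator norm of a nonnegative multiple of the identity is at most the factor. -/
lemma opNorm_smul_one_le {n : ℕ} {c : ℝ} (hc : 0 ≤ c) :
    opNorm (c • (1 : Matrix (Fin n) (Fin n) ℝ)) ≤ c := by
  rw [opNorm, map_smul, map_one, norm_smul, Real.norm_of_nonneg hc]
  exact mul_le_of_le_one_right hc ContinuousLinearMap.norm_id_le

/-- The operator norm of `c z zᵀ` is at least `c‖z‖²`. -/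
lemma le_opNorm_smul_vecMulVec {n : ℕ} (c : ℝ) (z : Euc n) :
    c * ‖z‖ ^ 2 ≤ opNorm (c • Matrix.vecMulVec z.ofLp z.ofLp) := by
  rcases eq_or_ne z 0 with rfl | hz
  · simp [opNorm]
  have hz' : 0 < ‖z‖ := norm_pos_iff.2 hz
  have h : Matrix.toEuclideanCLM (𝕜 := ℝ) (c • Matrix.vecMulVec z.ofLp z.ofLp) z =
      (c * ‖z‖ ^ 2) • z := by
    ext i
    simp [Matrix.ofLp_toEuclideanCLM, Matrix.vecMulVec_mulVec,
      EuclideanSpace.real_norm_sq_eq, dotProduct, ← sq]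
    ring
  have h' := (Matrix.toEuclideanCLM (𝕜 := ℝ) (c • Matrix.vecMulVec z.ofLp z.ofLp)).le_opNorm z
  rw [h, norm_smul] at h'
  exact (le_abs_self _).trans (le_of_mul_le_mul_right h' hz')

/-- A Gaussian with large enough exponent is a strict classical subsolution away from its
centre. -/
lemma UniformlyElliptic.pos_hess2_affine_add_gaussian {n : ℕ}
    {F : Matrix (Fin n) (Fin n) ℝ → ℝ} {lb ub : ℝ} (hF : UniformlyElliptic F lb ub)
    (hF0 : F 0 = 0) (hlb : 0 < lb) (hub : 0 ≤ ub) {a γ : ℝ} (ha : 0 < a) (hγ : 0 < γ)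
    (b : ℝ) (p y x : Euc n) (hx : ub < 2 * γ * lb * ‖x - y‖ ^ 2) :
    0 < F (hess2 (fun x => b + ⟪p, x⟫ + a * Real.exp (-γ * ‖x - y‖ ^ 2)) x) := by
  rw [hess2_affine_add_gaussian]
  set c := a * Real.exp (-γ * ‖x - y‖ ^ 2)
  have hc : 0 < c := by positivity
  have hc2 : 0 ≤ 2 * γ * c := by positivity
  have hI : ((2 * γ * c) • (1 : Matrix (Fin n) (Fin n) ℝ)).PosSemidef :=
    Matrix.PosSemidef.one.smul hc2
  have hV : ((4 * γ ^ 2 * c) • Matrix.vecMulVec (x - y).ofLp (x - y).ofLp).PosSemidef := by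
    have h := Matrix.posSemidef_vecMulVec_self_star (x - y).ofLp
    rw [star_trivial] at h
    exact h.smul (by positivity)
  have hs : (-((2 * γ * c) • (1 : Matrix (Fin n) (Fin n) ℝ))).IsSymm :=
    (Matrix.isSymm_one.smul _).neg
  have h1 := (hF _ _ hs hI).2
  have h2 := (hF _ _ hs hV).1
  rw [neg_add_cancel, hF0] at h1
  have h3 := mul_le_mul_of_nonneg_left (opNorm_smul_one_le (n := n) hc2) hub
  have h4 := mul_le_mul_of_nonneg_left
    (le_opNorm_smul_vecMulVec (4 * γ ^ 2 * c) (x - y)) hlb.le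
  have h5 : 0 < (2 * γ * c) * (2 * γ * lb * ‖x - y‖ ^ 2 - ub) :=
    mul_pos (by positivity) (sub_pos.2 hx)
  nlinarith

/-- Gaussian barrier: a supersolution that lies above an affine function plus a Gaussian on the
sphere of radius `R` and on the ball of radius `r` lies above it on the whole ball of radius
`R`. -/
lemma ViscSupersol.affine_add_gaussian_le {n : ℕ}
    {F : Matrix (Fin n) (Fin n) ℝ → ℝ} {lb ub : ℝ} (hF : UniformlyElliptic F lb ub)
    (hF0 : F 0 = 0) (hlb : 0 < lb) (hub : 0 ≤ ub) {Ω : Set (Euc n)}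
    {u : Euc n → ℝ} (hu : ContinuousOn u Ω) (hsup : ViscSupersol F Ω u)
    {a γ r R : ℝ} (ha : 0 < a) (hγ : 0 < γ) (hr : 0 ≤ r) {b : ℝ} {p y : Euc n}
    (hγr : ub ≤ 2 * γ * lb * r ^ 2) (hball : closedBall y R ⊆ Ω)
    (hin : ∀ x ∈ closedBall y R, ‖x - y‖ ≤ r →
      b + ⟪p, x⟫ + a * Real.exp (-γ * ‖x - y‖ ^ 2) ≤ u x)
    (hout : ∀ x, ‖x - y‖ = R → b + ⟪p, x⟫ + a * Real.exp (-γ * ‖x - y‖ ^ 2) ≤ u x)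
    {x : Euc n} (hx : x ∈ closedBall y R) :
    b + ⟪p, x⟫ + a * Real.exp (-γ * ‖x - y‖ ^ 2) ≤ u x := by
  have hcd : ∀ b : ℝ,
      ContDiff ℝ 2 fun x => b + ⟪p, x⟫ + a * Real.exp (-γ * ‖x - y‖ ^ 2) := by
    intro b
    have h := (contDiff_id (𝕜 := ℝ) (E := Euc n) (n := 2)).sub (contDiff_const (c := y))
    exact (contDiff_const.add (contDiff_const.inner ℝ contDiff_id)).add
      (contDiff_const.mul (contDiff_const.mul (h.norm_sq ℝ)).exp)
  obtain ⟨z, hz, hmin⟩ := (isCompact_closedBall y R).exists_isMinOn ⟨x, hx⟩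
    ((hu.mono hball).sub (hcd b).continuous.continuousOn)
  simp only [isMinOn_iff, Pi.sub_apply] at hmin
  by_contra! hlt
  have hzx := hmin x hx
  have hzr : r < ‖z - y‖ := by
    by_contra! h
    linarith [hin z hz h]
  have hzR : ‖z - y‖ < R := by
    refine lt_of_le_of_ne (mem_closedBall_iff_norm.1 hz) fun h => ?_
    linarith [hout z h]
  set m := u z - (b + ⟪p, z⟫ + a * Real.exp (-γ * ‖z - y‖ ^ 2)) with hm
  have hle := hsup z (hball hz) _ (hcd (b + m)) (by rw [hm]; ring) (by
    filter_upwards [isOpen_ball.mem_nhds (mem_ball_iff_norm.2 hzR)] with w hw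
    linarith [hmin w (ball_subset_closedBall hw)])
  have hsq : r ^ 2 < ‖z - y‖ ^ 2 := pow_lt_pow_left₀ hzr hr two_ne_zero
  have hpos := hF.pos_hess2_affine_add_gaussian hF0 hlb hub ha hγ (b + m) p y z
    (hγr.trans_lt (mul_lt_mul_of_pos_left hsq (by positivity)))
  linarith

/-- Quadratic oscillation control between two contact points for a
quadratically semiconvex obstacle. -/
theorem fully_nonlinear_quadratic_growth_between_contact_points
    (n : ℕ) (lb ub Cbar : ℝ) (hlb : 0 < lb) (hle : lb ≤ ub) (hCbar : 0 ≤ Cbar) :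
    ∃ K > 0, ∀ (F : Matrix (Fin n) (Fin n) ℝ → ℝ) (Ω : Set (Euc n))
      (u φ : Euc n → ℝ) (x₀ x₁ p : Euc n),
      UniformlyElliptic F lb ub → F 0 = 0 → IsOpen Ω →
      SolvesObstacle F Ω u φ →
      SemiconvexWithModulus Ω φ (fun r => Cbar * r ^ 2) →
      x₀ ∈ Ω → u x₀ = φ x₀ →
      x₁ ∈ Ω → u x₁ = φ x₁ →
      ball x₀ (4 * ‖x₁ - x₀‖) ⊆ Ω →
      IsLinearPartSlope Ω φ (fun r => Cbar * r ^ 2) x₀ p →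
      u x₁ - (φ x₀ + ⟪p, x₁ - x₀⟫) ≤ K * ‖x₁ - x₀‖ ^ 2 ∧
      φ x₁ - φ x₀ - ⟪p, x₁ - x₀⟫ ≤ K * ‖x₁ - x₀‖ ^ 2 := by
  have hub : 0 < ub := hlb.trans_le hle
  set s := ub / lb with hs
  have hspos : 0 < s := div_pos hub hlb
  set δ := Real.exp (-(2 * s) * (9 / 4)) - Real.exp (-(2 * s) * 4) with hδ
  have hδpos : 0 < δ := sub_pos.2 (Real.exp_lt_exp.2 (by linarith))
  refine ⟨Cbar * (1 + 16 / δ) + 1, by positivity, ?_⟩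
  intro F Ω u φ x₀ x₁ p hF hF0 _ ⟨hu, hφu, hsup, _, _⟩ hsc hx₀ hux₀ hx₁ hux₁ hball hp
  suffices h : u x₁ - (φ x₀ + ⟪p, x₁ - x₀⟫) ≤
      (Cbar * (1 + 16 / δ) + 1) * ‖x₁ - x₀‖ ^ 2 from ⟨h, by linarith⟩
  rcases eq_or_ne x₁ x₀ with rfl | hne
  · simp [hux₁]
  have hρ : 0 < ‖x₁ - x₀‖ := norm_pos_iff.2 (sub_ne_zero.2 hne)
  obtain ⟨q, hq⟩ := hsc x₁ hx₁
  obtain ⟨e, he, hqe⟩ := exists_unit_smul_eq (sub_ne_zero.2 hne) (q - p)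
  set ρ := ‖x₁ - x₀‖ with hρdef
  set a := u x₁ - (φ x₀ + ⟪p, x₁ - x₀⟫) - Cbar * ρ ^ 2 with ha
  suffices h : a ≤ Cbar * (16 / δ) * ρ ^ 2 by linarith [sq_nonneg ρ]
  rcases le_or_gt a 0 with ha0 | ha0
  · exact ha0.trans (by positivity)
  set y := x₁ + (ρ / 2) • e with hy
  have hx₁y : ‖y - x₁‖ = ρ / 2 := by
    rw [hy, add_sub_cancel_left, norm_smul, he, mul_one, Real.norm_of_nonneg (by positivity)]
  have hyx₀ : ‖y - x₀‖ ≤ 3 / 2 * ρ := by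
    linarith [norm_sub_le_norm_sub_add_norm_sub y x₁ x₀]
  have hdist : ∀ x ∈ closedBall y (2 * ρ), ‖x - x₀‖ < 4 * ρ := fun x hx => by
    linarith [norm_sub_le_norm_sub_add_norm_sub x y x₀, mem_closedBall_iff_norm.1 hx]
  have hsub : closedBall y (2 * ρ) ⊆ Ω := fun x hx =>
    hball (mem_ball_iff_norm.2 (hdist x hx))
  have hbelow : ∀ x ∈ closedBall y (2 * ρ),
      φ x₀ + ⟪p, x - x₀⟫ - 16 * Cbar * ρ ^ 2 ≤ u x := fun x hx => by
    have h1 := hp x (hsub hx)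
    have h2 := hφu x (hsub hx)
    have h3 := mul_le_mul_of_nonneg_left
      (pow_le_pow_left₀ (norm_nonneg _) (hdist x hx).le 2) hCbar
    simp only at h1
    linarith
  have hhalf : ∀ x ∈ closedBall y (2 * ρ), ‖x - y‖ ≤ ρ / 2 →
      a + (φ x₀ + ⟪p, x - x₀⟫) ≤ u x := fun x hx hxy => by
    have h1 := hq x (hsub hx)
    have h2 := hφu x (hsub hx)
    have hxx₁ : ‖x - x₁‖ ≤ ρ := by linarith [norm_sub_le_norm_sub_add_norm_sub x y x₁]
    have h3 := mul_le_mul_of_nonneg_left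
      (pow_le_pow_left₀ (norm_nonneg _) hxx₁ 2) hCbar
    have h4 : 0 ≤ ⟪q - p, x - x₁⟫ := by
      have hsplit : x - x₁ = (x - y) + (ρ / 2) • e := by rw [hy]; abel
      have hcs := (abs_le.1 (abs_real_inner_le_norm e (x - y))).1
      rw [he, one_mul] at hcs
      rw [hqe, hsplit, inner_add_right, real_inner_smul_left, real_inner_smul_left,
        real_inner_smul_right, real_inner_self_eq_norm_sq, he, ← mul_add]
      exact mul_nonneg (norm_nonneg _) (by linarith)
    have h5 : ⟪p, x - x₀⟫ = ⟪p, x - x₁⟫ + ⟪p, x₁ - x₀⟫ := by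
      rw [← inner_add_right, sub_add_sub_cancel]
    rw [inner_sub_left] at h4
    simp only at h1
    linarith
  have hexp : ∀ t : ℝ, -(2 * s / ρ ^ 2) * (t * ρ ^ 2) = -(2 * s) * t := fun t => by
    field_simp
  have hγr : ub ≤ 2 * (2 * s / ρ ^ 2) * lb * (ρ / 2) ^ 2 := by
    rw [hs]; field_simp; norm_num
  have key := hsup.affine_add_gaussian_le hF hF0 hlb hub.le hu (a := a) (γ := 2 * s / ρ ^ 2)
    (r := ρ / 2) (R := 2 * ρ) (p := p) (y := y)
    (b := φ x₀ - ⟪p, x₀⟫ - 16 * Cbar * ρ ^ 2 - a * Real.exp (-(2 * s) * 4))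
    ha0 (by positivity) (by positivity) hγr hsub
    (fun x hx hxy => by
      have h1 := hhalf x hx hxy
      have h2 : a * Real.exp (-(2 * s / ρ ^ 2) * ‖x - y‖ ^ 2) ≤ a :=
        mul_le_of_le_one_right ha0.le (Real.exp_le_one_iff.2 (by
          rw [neg_mul, neg_nonpos]; positivity))
      have h3 : 0 ≤ a * Real.exp (-(2 * s) * 4) := by positivity
      have h4 : 0 ≤ 16 * Cbar * ρ ^ 2 := by positivity
      rw [inner_sub_right] at h1
      linarith)
    (fun x hx => by
      have h1 := hbelow x (mem_closedBall_iff_norm.2 hx.le)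
      rw [inner_sub_right] at h1
      rw [hx, mul_pow, hexp]
      norm_num at h1 ⊢
      linarith)
    (x := x₀) (mem_closedBall_iff_norm'.2 (by linarith))
  have hx₀e : Real.exp (-(2 * s) * (9 / 4)) ≤
      Real.exp (-(2 * s / ρ ^ 2) * ‖x₀ - y‖ ^ 2) := by
    rw [← hexp, norm_sub_rev]
    refine Real.exp_le_exp.2 (mul_le_mul_of_nonpos_left ?_ (by
      rw [neg_nonpos]; positivity))
    calc ‖y - x₀‖ ^ 2 ≤ (3 / 2 * ρ) ^ 2 := pow_le_pow_left₀ (norm_nonneg _) hyx₀ 2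
      _ = 9 / 4 * ρ ^ 2 := by ring
  have haδ : a * δ ≤ 16 * Cbar * ρ ^ 2 := by
    have := mul_le_mul_of_nonneg_left hx₀e ha0.le
    rw [hδ, mul_sub]
    linarith
  calc a ≤ 16 * Cbar * ρ ^ 2 / δ := (le_div_iff₀ hδpos).2 haδ
    _ = Cbar * (16 / δ) * ρ ^ 2 := by ring
end
end

section
/- Let D ⊂ ℝⁿ be a nonempty compact set, let u, φ ∈ C(D) with φ(x) > 0 for all x ∈ D, and define Mu(x) = φ(x) + inf{ u(y) : y ∈ D, y ≥ x componentwise }. Assume u(x) ≤ Mu(x) for all x ∈ D. If x₀ ∈ D satisfies u(x₀) = Mu(x₀), and x ∈ D satisfies x ≥ x₀ and φ(x₀) + u(x) = Mu(x₀) (i.e. x belongs to the set Σ_{x₀} where the infimum defining Mu(x₀) is attained), then u(x) < Mu(x). -/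
open MeasureTheory Metric Set
open scoped RealInnerProductSpace

noncomputable section

/-- Points realizing the infimum defining `Mu(x₀)` at a contact point
`x₀` are non-contact points. -/
theorem infimum_points_are_noncontact
    (n : ℕ) (D : Set (Euc n)) (hD : IsCompact D) (hDne : D.Nonempty)
    (u φ : Euc n → ℝ) (hu : ContinuousOn u D) (hφ : ContinuousOn φ D)
    (hφpos : ∀ x ∈ D, 0 < φ x)
    (hle : ∀ x ∈ D, u x ≤ Mop D φ u x)
    (x₀ : Euc n) (hx₀ : x₀ ∈ D) (hx₀c : u x₀ = Mop D φ u x₀)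
    (x : Euc n) (hx : x ∈ D) (hxge : coneLE x₀ x)
    (hxinf : φ x₀ + u x = Mop D φ u x₀) :
    u x < Mop D φ u x := by
  have hbdd : BddBelow (u '' {y ∈ D | coneLE x₀ y}) :=
    (hD.image_of_continuousOn hu).bddBelow.mono (image_mono (sep_subset _ _))
  have hmono : sInf (u '' {y ∈ D | coneLE x₀ y}) ≤ sInf (u '' {y ∈ D | coneLE x y}) :=
    csInf_le_csInf hbdd ⟨u x, x, ⟨hx, fun _ => le_rfl⟩, rfl⟩
      (image_mono fun y hy => ⟨hy.1, fun i => (hxge i).trans (hy.2 i)⟩)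
  have hφx := hφpos x hx
  unfold Mop at hxinf ⊢
  linarith
end
end

section
/- Let D ⊂ ℝⁿ be a nonempty compact set, let u, φ ∈ C(D) with φ > 0 on D, define Mu(x) = φ(x) + inf{ u(y) : y ∈ D, y ≥ x componentwise }, and assume Mu is continuous on D and u ≤ Mu on D. Let x₀ ∈ D with u(x₀) = Mu(x₀) and let Σ_{x₀} = { x ∈ D : x ≥ x₀ and φ(x₀) + u(x) = Mu(x₀) }. Then there exists δ₀ > 0 such that dist( {x ∈ D : u(x) = Mu(x)}, Σ_{x₀} ) > δ₀, i.e. |x − y| > δ₀ for every contact point x (u(x) = Mu(x)) and every y ∈ Σ_{x₀}. -/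
open MeasureTheory Metric Set
open scoped RealInnerProductSpace

noncomputable section

/-- Points where the infimum defining `Mu(x₀)` is attained satisfy `φ + u ≤ Mu`. -/
theorem add_le_Mop_of_attains {n : ℕ} {D : Set (Euc n)} (hD : IsCompact D)
    {u φ : Euc n → ℝ} (hu : ContinuousOn u D) {x₀ y : Euc n} (hy : y ∈ D)
    (hxy : coneLE x₀ y) (hmin : φ x₀ + u y = Mop D φ u x₀) :
    φ y + u y ≤ Mop D φ u y := by
  have huy : u y = sInf (u '' {z ∈ D | coneLE x₀ z}) := add_left_cancel hmin
  suffices h : u y ≤ sInf (u '' {z ∈ D | coneLE y z}) from add_le_add_right h (φ y)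
  refine le_csInf ⟨u y, y, ⟨hy, fun _ => le_rfl⟩, rfl⟩ ?_
  rintro _ ⟨z, ⟨hz, hyz⟩, rfl⟩
  rw [huy]
  exact csInf_le ((hD.bddBelow_image hu).mono (image_mono (sep_subset _ _)))
    ⟨z, ⟨hz, fun i => (hxy i).trans (hyz i)⟩, rfl⟩

/-- The set `Σ_{x₀}` where the infimum defining `Mu(x₀)` is attained is
uniformly away from the contact set. -/
theorem infimum_set_uniformly_away_from_contact_set
    (n : ℕ) (D : Set (Euc n)) (hD : IsCompact D) (hDne : D.Nonempty)
    (u φ : Euc n → ℝ) (hu : ContinuousOn u D) (hφ : ContinuousOn φ D)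
    (hφpos : ∀ x ∈ D, 0 < φ x)
    (hM : ContinuousOn (Mop D φ u) D)
    (hle : ∀ x ∈ D, u x ≤ Mop D φ u x)
    (x₀ : Euc n) (hx₀ : x₀ ∈ D) (hx₀c : u x₀ = Mop D φ u x₀) :
    ∃ δ₀ > 0, ∀ x ∈ D, u x = Mop D φ u x →
      ∀ y ∈ D, coneLE x₀ y → φ x₀ + u y = Mop D φ u x₀ →
        δ₀ < dist x y := by
  obtain ⟨z, hz, hzmin⟩ := hD.exists_isMinOn hDne hφ
  have huc := hD.uniformContinuousOn_of_continuous (hM.sub hu)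
  obtain ⟨δ, hδ, hδD⟩ := Metric.uniformContinuousOn_iff.mp huc (φ z) (hφpos z hz)
  refine ⟨δ / 2, half_pos hδ, fun x hx hxc y hy hxy hmin => ?_⟩
  by_contra! hdist
  have hclose := hδD x hx y hy (hdist.trans_lt (half_lt_self hδ))
  have hgap := add_le_Mop_of_attains hD hu hy hxy hmin
  have hφy : φ z ≤ φ y := hzmin hy
  rw [Real.dist_eq, abs_lt] at hclose
  simp only [Pi.sub_apply] at hclose
  linarith [hclose.1]
end
end

section
/- Let D ⊂ ℝⁿ be a nonempty compact set, let u, φ ∈ C(D) with φ > 0 on D, define Mu(x) = φ(x) + inf{ u(y) : y ∈ D, y ≥ x componentwise }, and assume u ≤ Mu on D. Then for every x ∈ D the infimum defining Mu(x) is realized at a non-contact point: there exists x̄ ∈ D with x̄ ≥ x, u(x̄) = inf{ u(y) : y ∈ D, y ≥ x }, and u(x̄) < Mu(x̄). -/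
open MeasureTheory Metric Set
open scoped RealInnerProductSpace

noncomputable section

/-- The infimum defining `Mu(x)` is always realized at a non-contact
point. -/
theorem infimum_realized_at_noncontact_point
    (n : ℕ) (D : Set (Euc n)) (hD : IsCompact D) (hDne : D.Nonempty)
    (u φ : Euc n → ℝ) (hu : ContinuousOn u D) (hφ : ContinuousOn φ D)
    (hφpos : ∀ x ∈ D, 0 < φ x)
    (hle : ∀ x ∈ D, u x ≤ Mop D φ u x) :
    ∀ x ∈ D, ∃ x' ∈ D, coneLE x x' ∧
      u x' = sInf (u '' {y ∈ D | coneLE x y}) ∧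
      u x' < Mop D φ u x' := by
  intro x hx
  have hclosed : IsClosed {y : Euc n | coneLE x y} := by
    simp only [coneLE, ofPred_forall]
    exact isClosed_iInter fun i => isClosed_le continuous_const (by fun_prop)
  have hcompact : IsCompact {y ∈ D | coneLE x y} := hD.inter_right hclosed
  have hne : {y ∈ D | coneLE x y}.Nonempty := ⟨x, hx, fun _ => le_rfl⟩
  obtain ⟨z, ⟨hzD, hxz⟩, hz, hmin⟩ :=
    hcompact.exists_sInf_image_eq_and_le hne (hu.mono fun _ hy => hy.1)
  refine ⟨z, hzD, hxz, hz.symm, ?_⟩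
  have hlower : u z ≤ sInf (u '' {y ∈ D | coneLE z y}) := by
    have hself : z ∈ {y ∈ D | coneLE z y} := ⟨hzD, fun _ => le_rfl⟩
    apply le_csInf ⟨u z, mem_image_of_mem u hself⟩
    rintro _ ⟨y, ⟨hyD, hzy⟩, rfl⟩
    exact hmin y ⟨hyD, fun i => (hxz i).trans (hzy i)⟩
  have hpos := hφpos z hzD
  simp only [Mop]
  linarith
end
end
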